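/- arXiv:1908.06957 — 3 statements merged into one kernel-verified Lean document; each statement's English description precedes it below -/
import Mathlib

section
/- Fix positive integers L, K, M. For every ε > 0 there exists q₀ such that for every finite field F with |F| = q ≥ q₀ the following holds: if A and B are independent random matrices, with A uniformly distributed on F^{L×K} and B uniformly distributed on F^{K×M}, then |H(AB)/log q − v| < ε, where v = L·M if K ≥ min(L, M), and v = L·K + K·M − K² if K < min(L, M). -/
open scoped BigOperators Classical

noncomputable section

namespace SDMM

variable {Ω : Type} [Fintype Ω]

/-- The probability that the random variable `X` (on finite sample space `Ω`
with probability mass function `p`) takes the value `a`. -/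
def distOf (p : Ω → ℝ) {α : Type*} (X : Ω → α) (a : α) : ℝ :=
  ∑ ω, if X ω = a then p ω else 0

/-- `p` is a probability mass function on `Ω`. -/
def IsPMF (p : Ω → ℝ) : Prop := (∀ ω, 0 ≤ p ω) ∧ ∑ ω, p ω = 1

/-- Shannon entropy (natural-log units) of the random variable `X`. -/
def H (p : Ω → ℝ) {α : Type*} [Fintype α] (X : Ω → α) : ℝ :=
  ∑ a, Real.negMulLog (distOf p X a)

/-- Conditional Shannon entropy `H(X | Y) = H(X, Y) - H(Y)`. -/
def Hc (p : Ω → ℝ) {α β : Type*} [Fintype α] [Fintype β] (X : Ω → α) (Y : Ω → β) : ℝ :=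
  H p (fun ω => (X ω, Y ω)) - H p Y

/-- Mutual information `I(X ; Y) = H(X) + H(Y) - H(X, Y)`. -/
def MI (p : Ω → ℝ) {α β : Type*} [Fintype α] [Fintype β] (X : Ω → α) (Y : Ω → β) : ℝ :=
  H p X + H p Y - H p (fun ω => (X ω, Y ω))

/-- Conditional mutual information `I(X ; Y | Z)`. -/
def CMI (p : Ω → ℝ) {α β γ : Type*} [Fintype α] [Fintype β] [Fintype γ]
    (X : Ω → α) (Y : Ω → β) (Z : Ω → γ) : ℝ :=
  H p (fun ω => (X ω, Z ω)) + H p (fun ω => (Y ω, Z ω))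
    - H p (fun ω => (X ω, Y ω, Z ω)) - H p Z

/-- `X` is uniformly distributed on `α`. -/
def Uniform (p : Ω → ℝ) {α : Type*} [Fintype α] (X : Ω → α) : Prop :=
  ∀ a, distOf p X a = 1 / Fintype.card α

/-- `X` and `Y` are independent random variables. -/
def IndepRV (p : Ω → ℝ) {α β : Type*} (X : Ω → α) (Y : Ω → β) : Prop :=
  ∀ a b, distOf p (fun ω => (X ω, Y ω)) (a, b) = distOf p X a * distOf p Y b

end SDMM

namespace SDMM

open MvPolynomial in
lemma card_mul_card_eval_eq_zero_le {F σ : Type} [Field F] [Fintype F] [Fintype σ] [DecidableEq σ]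
    {P : MvPolynomial σ F} (hP : P ≠ 0) :
    Fintype.card F * (Finset.univ.filter fun x : σ → F => eval x P = 0).card ≤
      P.totalDegree * Fintype.card F ^ Fintype.card σ := by
  let e := Fintype.equivFin σ
  have hP' : rename e P ≠ 0 := fun h =>
    hP (rename_injective e e.injective (h.trans (map_zero _).symm))
  have key := schwartz_zippel_totalDegree hP' (Finset.univ : Finset F)
  have hcard : (Finset.univ.filter fun x : σ → F => eval x P = 0).card =
      ((Fintype.piFinset fun _ : Fin (Fintype.card σ) => (Finset.univ : Finset F)).filter
        fun f => eval f (rename e P) = 0).card := by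
    refine Finset.card_equiv (Equiv.arrowCongr e (Equiv.refl F)) fun x => ?_
    simp only [Finset.mem_filter, Finset.mem_univ, true_and, Fintype.mem_piFinset, eval_rename]
    have : ((Equiv.arrowCongr e (Equiv.refl F)) x) ∘ e = x := by
      ext i; simp [Equiv.arrowCongr]
    rw [this]
    simp
  rw [← hcard, div_le_div_iff₀ (by simp [Fintype.card_pos]) (by simp [Fintype.card_pos])] at key
  have key' : (Finset.univ.filter fun x : σ → F => eval x P = 0).card * Fintype.card F ≤
      (rename e P).totalDegree * Fintype.card F ^ Fintype.card σ := by
    exact_mod_cast key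
  rw [mul_comm]
  exact key'.trans (Nat.mul_le_mul_right _ (totalDegree_rename_le _ _))

open MvPolynomial in
/-- All but a fraction `2r / q` of the pairs of matrices have a product of rank at least `r`. -/
lemma card_mul_card_rank_mul_lt_le (F : Type) [Field F] [Fintype F] {L K M r : ℕ}
    (hL : r ≤ L) (hK : r ≤ K) (hM : r ≤ M) :
    Fintype.card F * (Finset.univ.filter
      fun x : Matrix (Fin L) (Fin K) F × Matrix (Fin K) (Fin M) F => (x.1 * x.2).rank < r).card ≤
      2 * r * Fintype.card F ^ (L * K + K * M) := by
  let σ := (Fin L × Fin K) ⊕ (Fin K × Fin M)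
  let XA : Matrix (Fin L) (Fin K) (MvPolynomial σ F) := Matrix.of fun i j => X (Sum.inl (i, j))
  let XB : Matrix (Fin K) (Fin M) (MvPolynomial σ F) := Matrix.of fun i j => X (Sum.inr (i, j))
  let P : MvPolynomial σ F := ((XA * XB).submatrix (Fin.castLE hL) (Fin.castLE hM)).det
  let g : Matrix (Fin L) (Fin K) F × Matrix (Fin K) (Fin M) F → σ → F := fun x =>
    Sum.elim (fun ij => x.1 ij.1 ij.2) (fun ij => x.2 ij.1 ij.2)
  have heval : ∀ x, eval (g x) P =
      ((x.1 * x.2).submatrix (Fin.castLE hL) (Fin.castLE hM)).det := by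
    intro x
    rw [RingHom.map_det]
    congr 1
    ext i j
    simp [XA, XB, g, Matrix.mul_apply]
  have hP : P ≠ 0 := by
    intro h
    have h1 := heval (Matrix.of fun i j => if i.val = j.val then 1 else 0,
      Matrix.of fun i j => if i.val = j.val then 1 else 0)
    rw [h, map_zero] at h1
    have h2 : (((Matrix.of fun i j => if i.val = j.val then 1 else 0 : Matrix (Fin L) (Fin K) F) *
        (Matrix.of fun i j => if i.val = j.val then 1 else 0 :
          Matrix (Fin K) (Fin M) F)).submatrix (Fin.castLE hL) (Fin.castLE hM)) = 1 := by
      ext i j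
      rw [Matrix.submatrix_apply, Matrix.mul_apply, Finset.sum_eq_single (Fin.castLE hK i)]
      · simp [Matrix.one_apply, Fin.ext_iff]
      · intro k _ hk
        have : ¬ (i.val = k.val) := fun h => hk (Fin.ext (by simp [h]))
        simp [this]
      · simp
    rw [h2] at h1
    simp at h1
  have hdeg : P.totalDegree ≤ 2 * r := by
    have hentry : ∀ i j, ((XA * XB) i j).totalDegree ≤ 2 := by
      intro i j
      rw [Matrix.mul_apply]
      refine totalDegree_finsetSum_le fun k _ => (totalDegree_mul _ _).trans ?_
      simp [XA, XB, totalDegree_X]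
    simp only [P, Matrix.det_apply]
    refine totalDegree_finsetSum_le fun s _ => ?_
    have h := (totalDegree_finsetProd Finset.univ fun i : Fin r =>
      ((XA * XB).submatrix (Fin.castLE hL) (Fin.castLE hM)) (s i) i).trans
        (Finset.sum_le_card_nsmul _ _ 2 fun i _ => hentry _ _)
    rw [Finset.card_univ, Fintype.card_fin, smul_eq_mul, mul_comm] at h
    rcases Int.units_eq_one_or (Equiv.Perm.sign s) with hs | hs <;> simpa [hs] using h
  have hle : (Finset.univ.filter
      fun x : Matrix (Fin L) (Fin K) F × Matrix (Fin K) (Fin M) F => (x.1 * x.2).rank < r).card ≤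
      (Finset.univ.filter fun x : σ → F => eval x P = 0).card := by
    refine Finset.card_le_card_of_injOn g (fun x hx => ?_) fun x _ y _ hxy => ?_
    · simp only [Finset.coe_filter, Finset.mem_univ, true_and, Set.mem_ofPred_eq] at hx ⊢
      rw [heval]
      by_contra hdet
      have h1 := Matrix.rank_of_det_ne_zero hdet
      have h2 := Matrix.rank_submatrix_le (x.1 * x.2) (Fin.castLE hL) (Fin.castLE hM)
      rw [h1, Fintype.card_fin] at h2
      omega
    · refine Prod.ext (Matrix.ext fun i j => ?_) (Matrix.ext fun i j => ?_)
      · exact congrFun hxy (Sum.inl (i, j))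
      · exact congrFun hxy (Sum.inr (i, j))
  have hσ : Fintype.card σ = L * K + K * M := by simp [σ]
  calc _ ≤ _ := Nat.mul_le_mul_left _ hle
    _ ≤ _ := card_mul_card_eval_eq_zero_le hP
    _ ≤ _ := by rw [hσ]; exact Nat.mul_le_mul_right _ hdeg

/-- A matrix of the maximal possible rank `r = min L K` of a product has few factorisations. -/
lemma card_factorizations_le {F : Type} [Field F] [Fintype F] {L K M r : ℕ}
    (hr : r = min L K) {C : Matrix (Fin L) (Fin M) F} (hC : C.rank = r) :
    (Finset.univ.filter
      fun x : Matrix (Fin L) (Fin K) F × Matrix (Fin K) (Fin M) F => x.1 * x.2 = C).card ≤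
      Fintype.card F ^ (r * K + (K - r) * M) := by
  let W := LinearMap.range C.mulVecLin
  have hW : Module.finrank F W = r := hC
  have hrange : ∀ (A : Matrix (Fin L) (Fin K) F) (B : Matrix (Fin K) (Fin M) F), A * B = C →
      LinearMap.range A.mulVecLin = W := by
    intro A B h
    have hle : W ≤ LinearMap.range A.mulVecLin := by
      simp only [W, ← h, Matrix.mulVecLin_mul]
      exact LinearMap.range_comp_le_range _ _
    refine (Submodule.eq_of_le_of_finrank_le hle ?_).symm
    rw [hW, hr]
    exact le_min A.rank_le_height A.rank_le_width
  let S : Finset (Matrix (Fin L) (Fin K) F) := Finset.univ.filter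
    fun A => LinearMap.range A.mulVecLin = W
  have hS : S.card ≤ Fintype.card F ^ (r * K) := by
    have hcard : Fintype.card (Fin K → W) = Fintype.card F ^ (r * K) := by
      rw [Fintype.card_fun, Module.card_eq_pow_finrank (K := F), hW, Fintype.card_fin, pow_mul]
    rw [← hcard, ← Fintype.card_coe]
    refine Fintype.card_le_of_injective (fun A j => ⟨A.1.col j, ?_⟩) fun A A' h => ?_
    · have hA := (Finset.mem_filter.mp A.2).2
      rw [← hA]
      exact ⟨Pi.single j 1, by simp⟩
    · refine Subtype.ext (Matrix.ext fun i j => ?_)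
      exact congrFun (congrArg Subtype.val (congrFun h j)) i
  have hfib : ∀ A ∈ S, (Finset.univ.filter
      fun B : Matrix (Fin K) (Fin M) F => A * B = C).card ≤ Fintype.card F ^ ((K - r) * M) := by
    intro A hA
    rcases Finset.eq_empty_or_nonempty (Finset.univ.filter
      fun B : Matrix (Fin K) (Fin M) F => A * B = C) with he | ⟨B₀, hB₀⟩
    · simp [he]
    have hker : Module.finrank F (LinearMap.ker A.mulVecLin) = K - r := by
      have h1 := LinearMap.finrank_range_add_finrank_ker A.mulVecLin
      rw [(Finset.mem_filter.mp hA).2, hW] at h1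
      simp at h1
      omega
    have hcard : Fintype.card (Fin M → LinearMap.ker A.mulVecLin) =
        Fintype.card F ^ ((K - r) * M) := by
      rw [Fintype.card_fun, Module.card_eq_pow_finrank (K := F), hker, Fintype.card_fin, pow_mul]
    rw [← hcard, ← Fintype.card_coe]
    refine Fintype.card_le_of_injective (fun B j => ⟨(B.1 - B₀).col j, ?_⟩) fun B B' h => ?_
    · have h1 : A * (B.1 - B₀) = 0 := by
        rw [Matrix.mul_sub, (Finset.mem_filter.mp B.2).2, (Finset.mem_filter.mp hB₀).2, sub_self]
      rw [LinearMap.mem_ker]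
      ext i
      exact congrFun (congrFun h1 i) j
    · refine Subtype.ext (Matrix.ext fun i j => ?_)
      have := congrFun (congrArg Subtype.val (congrFun h j)) i
      simpa using this
  calc _ ≤ (S.sigma fun A => Finset.univ.filter
        fun B : Matrix (Fin K) (Fin M) F => A * B = C).card := by
        refine Finset.card_le_card_of_injOn (fun x => ⟨x.1, x.2⟩) (fun x hx => ?_) ?_
        · simp only [Finset.coe_filter, Finset.mem_univ, true_and, Set.mem_ofPred_eq] at hx
          simp [S, hx, hrange _ _ hx]
        · rintro ⟨a, b⟩ _ ⟨a', b'⟩ _ h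
          simpa using h
    _ = ∑ A ∈ S, _ := Finset.card_sigma _ _
    _ ≤ S.card • Fintype.card F ^ ((K - r) * M) := Finset.sum_le_card_nsmul _ _ _ hfib
    _ ≤ _ := by rw [smul_eq_mul, pow_add]; exact Nat.mul_le_mul_right _ hS

lemma card_factorizations_le_of_transpose {F : Type} [Field F] [Fintype F] {L K M r : ℕ}
    (hr : r = min M K) {C : Matrix (Fin L) (Fin M) F} (hC : C.rank = r) :
    (Finset.univ.filter
      fun x : Matrix (Fin L) (Fin K) F × Matrix (Fin K) (Fin M) F => x.1 * x.2 = C).card ≤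
      Fintype.card F ^ (r * K + (K - r) * L) := by
  refine le_trans (Finset.card_le_card_of_injOn (fun x => (x.2.transpose, x.1.transpose))
    (fun x hx => ?_) ?_)
    (card_factorizations_le hr (C := C.transpose) (by rw [Matrix.rank_transpose, hC]))
  · simp only [Finset.coe_filter, Finset.mem_univ, true_and, Set.mem_ofPred_eq] at hx ⊢
    rw [← hx, Matrix.transpose_mul]
  · rintro ⟨a, b⟩ _ ⟨a', b'⟩ _ h
    simpa [and_comm] using h

/-- The rows of `A` are combinations of `K` of them. -/
lemma exists_rows_span {F : Type} [Field F] {L K : ℕ} (hK : K ≤ L)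
    (A : Matrix (Fin L) (Fin K) F) :
    ∃ s : Finset (Fin L), s.card = K ∧ ∀ i, ∃ c : s → F, A i = ∑ j, c j • A j := by
  obtain ⟨κ, a, ha, hspan, hli⟩ := exists_linearIndependent' F (fun i => A i)
  have : Fintype κ := Fintype.ofInjective a ha
  have hκ : Fintype.card κ ≤ K := by simpa using hli.fintype_card_le_finrank
  obtain ⟨s, hs, -, hcard⟩ := Finset.exists_subsuperset_card_eq
    (Finset.subset_univ (Finset.univ.image a)) (Finset.card_image_le.trans hκ) (by simpa using hK)
  refine ⟨s, hcard, fun i => ?_⟩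
  have hmem : A i ∈ Submodule.span F (Set.range fun j : s => A j) := by
    have h1 : A i ∈ Submodule.span F (Set.range fun i => A i) :=
      Submodule.subset_span ⟨i, rfl⟩
    rw [← hspan] at h1
    refine Submodule.span_mono ?_ h1
    rintro _ ⟨k, rfl⟩
    exact ⟨⟨a k, hs (Finset.mem_image_of_mem a (Finset.mem_univ k))⟩, rfl⟩
  obtain ⟨c, hc⟩ := (Submodule.mem_span_range_iff_exists_fun F).mp hmem
  exact ⟨c, hc.symm⟩

/-- There are at most `2 ^ L * q ^ (K * M + (L - K) * K)` matrices that are products. -/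
lemma card_image_mul_le (F : Type) [Field F] [Fintype F] {L K M : ℕ} (hK : K ≤ L) :
    (Finset.univ.image
      fun x : Matrix (Fin L) (Fin K) F × Matrix (Fin K) (Fin M) F => x.1 * x.2).card ≤
      2 ^ L * Fintype.card F ^ (K * M + (L - K) * K) := by
  let D := fun s : Finset (Fin L) =>
    (s → Fin M → F) × ({i // i ∉ s} → s → F)
  let g : (Σ s : {s : Finset (Fin L) // s.card = K}, D s.1) → Matrix (Fin L) (Fin M) F := fun x i =>
    if h : i ∈ x.1.1 then x.2.1 ⟨i, h⟩ else ∑ j, x.2.2 ⟨i, h⟩ j • x.2.1 j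
  have hsub : (Finset.univ.image
      fun x : Matrix (Fin L) (Fin K) F × Matrix (Fin K) (Fin M) F => x.1 * x.2) ⊆
      Finset.univ.image g := by
    intro C hC
    obtain ⟨⟨A, B⟩, -, rfl⟩ := Finset.mem_image.mp hC
    obtain ⟨s, hs, hrow⟩ := exists_rows_span hK A
    choose c hc using hrow
    refine Finset.mem_image.mpr
      ⟨⟨⟨s, hs⟩, fun j => (A * B) j, fun i => c i⟩, Finset.mem_univ _, ?_⟩
    ext i m
    by_cases h : i ∈ s
    · simp [g, h]
    · simp only [g, h, dite_false, Finset.sum_apply, Pi.smul_apply, smul_eq_mul, Matrix.mul_apply]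
      simp_rw [Finset.mul_sum]
      rw [Finset.sum_comm]
      refine Finset.sum_congr rfl fun k _ => ?_
      rw [hc i]
      simp [Finset.sum_apply, Finset.sum_mul, mul_assoc]
  have hD : ∀ s : {s : Finset (Fin L) // s.card = K},
      Fintype.card (D s.1) = Fintype.card F ^ (K * M + (L - K) * K) := by
    rintro ⟨s, hs⟩
    have h1 : Fintype.card {i // i ∉ s} = L - K := by
      rw [Fintype.card_subtype_compl, Fintype.card_fin, Fintype.card_coe, hs]
    simp only [D, Fintype.card_prod, Fintype.card_fun, h1, Fintype.card_coe, hs, Fintype.card_fin]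
    rw [← pow_mul, ← pow_mul, ← pow_add, mul_comm M K, mul_comm K (L - K)]
  calc _ ≤ _ := Finset.card_le_card hsub
    _ ≤ _ := Finset.card_image_le
    _ = Fintype.card {s : Finset (Fin L) // s.card = K} *
        Fintype.card F ^ (K * M + (L - K) * K) := by
      rw [Finset.card_univ, Fintype.card_sigma]
      simp [hD]
    _ ≤ _ := by
      refine Nat.mul_le_mul_right _ ((Fintype.card_subtype_le _).trans ?_)
      simp

section Entropy

variable {Ω : Type} [Fintype Ω] {p : Ω → ℝ} {α β : Type*}

lemma distOf_nonneg (hp : IsPMF p) (X : Ω → α) (a : α) : 0 ≤ distOf p X a :=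
  Finset.sum_nonneg fun ω _ => by split_ifs; exacts [hp.1 ω, le_rfl]

lemma sum_distOf_eq_one (hp : IsPMF p) (X : Ω → α) {T : Finset α} (hT : ∀ ω, X ω ∈ T) :
    ∑ a ∈ T, distOf p X a = 1 := by
  simp only [distOf]
  rw [Finset.sum_comm, ← hp.2]
  exact Finset.sum_congr rfl fun ω _ => by simp [hT ω]

lemma distOf_le_one [Fintype α] (hp : IsPMF p) (X : Ω → α) (a : α) : distOf p X a ≤ 1 := by
  rw [← sum_distOf_eq_one hp X (T := Finset.univ) (by simp)]
  exact Finset.single_le_sum (fun b _ => distOf_nonneg hp X b) (Finset.mem_univ a)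

/-- The entropy is at most the logarithm of the size of the support. -/
lemma H_le_log_card [Fintype α] (hp : IsPMF p) (X : Ω → α) {T : Finset α}
    (hT : ∀ ω, X ω ∈ T) : H p X ≤ Real.log T.card := by
  have hsum := sum_distOf_eq_one hp X hT
  have hpos : 0 < (T.card : ℝ) := by
    rcases T.eq_empty_or_nonempty with rfl | h
    · simp at hsum
    · exact_mod_cast h.card_pos
  have hH : H p X = ∑ a ∈ T, Real.negMulLog (distOf p X a) := by
    refine (Finset.sum_subset (Finset.subset_univ T) fun a _ ha => ?_).symm
    have : distOf p X a = 0 :=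
      Finset.sum_eq_zero fun ω _ => if_neg fun (h : X ω = a) => ha (h ▸ hT ω)
    simp [this]
  have key := Real.concaveOn_negMulLog.le_map_sum (t := T) (w := fun _ => (T.card : ℝ)⁻¹)
    (p := fun a => distOf p X a) (fun _ _ => by positivity)
    (by simp [hpos.ne']) (fun a _ => distOf_nonneg hp X a)
  simp only [smul_eq_mul, ← Finset.mul_sum, hsum, ← hH, mul_one] at key
  rw [Real.negMulLog, Real.log_inv, neg_mul_neg] at key
  exact le_of_mul_le_mul_left key (inv_pos.mpr hpos)

/-- The entropy is large when most of the mass sits on values of small probability. -/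
lemma sum_distOf_mul_le_H [Fintype α] (hp : IsPMF p) (X : Ω → α) {G : Finset α} {t : ℝ}
    (hG : ∀ a ∈ G, distOf p X a ≤ Real.exp (-t)) :
    (∑ a ∈ G, distOf p X a) * t ≤ H p X := by
  rw [Finset.sum_mul]
  refine le_trans (Finset.sum_le_sum (g := fun a => Real.negMulLog (distOf p X a))
    fun a ha => ?_) (Finset.sum_le_sum_of_subset_of_nonneg (Finset.subset_univ G)
      fun a _ _ => Real.negMulLog_nonneg (distOf_nonneg hp X a) (distOf_le_one hp X a))
  rcases (distOf_nonneg hp X a).eq_or_lt with h | h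
  · simp [← h]
  · have hlog : Real.log (distOf p X a) ≤ -t := (Real.log_le_iff_le_exp h).mpr (hG a ha)
    simp only [Real.negMulLog]
    nlinarith

/-- The law of a function of a uniform random variable is given by counting. -/
lemma sum_distOf_comp_uniform [Fintype α] [DecidableEq β] {Z : Ω → α} (hZ : Uniform p Z) (f : α → β)
    (G : Finset β) :
    ∑ b ∈ G, distOf p (fun ω => f (Z ω)) b =
      (Finset.univ.filter fun z => f z ∈ G).card / (Fintype.card α : ℝ) := by
  have h1 : ∑ b ∈ G, distOf p (fun ω => f (Z ω)) b =
      ∑ z ∈ Finset.univ.filter (fun z => f z ∈ G), distOf p Z z := by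
    simp only [distOf]
    rw [Finset.sum_comm, Finset.sum_comm (s := Finset.univ.filter _)]
    refine Finset.sum_congr rfl fun ω _ => ?_
    simp only [Finset.sum_ite_eq, Finset.mem_filter, Finset.mem_univ, true_and]
    convert Finset.sum_ite_eq G (f (Z ω)) fun _ => p ω
  rw [h1, Finset.sum_congr rfl fun z _ => hZ z]
  simp [div_eq_mul_inv]

lemma Uniform.prodMk [Fintype α] [Fintype β] {X : Ω → α} {Y : Ω → β} (hX : Uniform p X)
    (hY : Uniform p Y) (h : IndepRV p X Y) : Uniform p fun ω => (X ω, Y ω) := by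
  rintro ⟨a, b⟩
  rw [h, hX, hY, Fintype.card_prod]
  push_cast
  rw [div_mul_div_comm, one_mul]

end Entropy

lemma card_matrix_fin (F : Type) [Fintype F] (m n : ℕ) :
    Fintype.card (Matrix (Fin m) (Fin n) F) = Fintype.card F ^ (m * n) := by
  rw [Fintype.card_congr Matrix.of.symm]
  simp [← pow_mul, mul_comm]

lemma le_H_mul {F Ω : Type} [Field F] [Fintype F] [Fintype Ω] {p : Ω → ℝ} (hp : IsPMF p)
    {L K M r v w : ℕ} {A : Ω → Matrix (Fin L) (Fin K) F} {B : Ω → Matrix (Fin K) (Fin M) F}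
    (hA : Uniform p A) (hB : Uniform p B) (hAB : IndepRV p A B)
    (hL : r ≤ L) (hK : r ≤ K) (hM : r ≤ M) (hr : r = L ∨ r = K ∨ r = M)
    (hvw : v + w = L * K + K * M)
    (hcount : ∀ C : Matrix (Fin L) (Fin M) F, C.rank = r → (Finset.univ.filter
      fun x : Matrix (Fin L) (Fin K) F × Matrix (Fin K) (Fin M) F => x.1 * x.2 = C).card ≤
      Fintype.card F ^ w) :
    (1 - 2 * r / Fintype.card F) * (v * Real.log (Fintype.card F)) ≤
      H p (fun ω => A ω * B ω) := by
  set q := Fintype.card F with hq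
  have hq0 : (0 : ℝ) < q := by exact_mod_cast Fintype.card_pos
  have hZ := hA.prodMk hB hAB
  have htotal : Fintype.card (Matrix (Fin L) (Fin K) F × Matrix (Fin K) (Fin M) F) =
      q ^ (L * K + K * M) := by
    rw [Fintype.card_prod, card_matrix_fin, card_matrix_fin, pow_add]
  have hsum := sum_distOf_comp_uniform hZ fun x => x.1 * x.2
  rw [htotal] at hsum
  push_cast at hsum
  let G : Finset (Matrix (Fin L) (Fin M) F) := Finset.univ.filter fun C => C.rank = r
  have hrank : ∀ x : Matrix (Fin L) (Fin K) F × Matrix (Fin K) (Fin M) F,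
      (x.1 * x.2).rank ≤ r := by
    intro x
    rcases hr with rfl | rfl | rfl
    · exact Matrix.rank_le_height _
    · exact (Matrix.rank_mul_le_left _ _).trans (Matrix.rank_le_width _)
    · exact Matrix.rank_le_width _
  have hG : 1 - 2 * r / (q : ℝ) ≤ ∑ C ∈ G, distOf p (fun ω => A ω * B ω) C := by
    rw [hsum G, le_div_iff₀ (by positivity)]
    have hbad := card_mul_card_rank_mul_lt_le F hL hK hM
    have hsplit := Finset.card_filter_add_card_filter_not (s := Finset.univ)
      fun x : Matrix (Fin L) (Fin K) F × Matrix (Fin K) (Fin M) F => (x.1 * x.2).rank < r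
    rw [Finset.card_univ, htotal] at hsplit
    have hgood : (Finset.univ.filter
        fun x : Matrix (Fin L) (Fin K) F × Matrix (Fin K) (Fin M) F =>
          ¬ (x.1 * x.2).rank < r) = Finset.univ.filter fun x => x.1 * x.2 ∈ G := by
      ext x
      have := hrank x
      simp only [Finset.mem_filter, Finset.mem_univ, true_and, G]
      omega
    rw [hgood] at hsplit
    rw [← hq] at hbad
    have hbad' := (Nat.cast_le (α := ℝ)).mpr hbad
    have hsplit' := congrArg (Nat.cast (R := ℝ)) hsplit
    push_cast at hbad' hsplit'
    rw [mul_comm, ← le_div_iff₀ hq0] at hbad'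
    have hring : (1 - 2 * r / (q : ℝ)) * (q : ℝ) ^ (L * K + K * M) =
        (q : ℝ) ^ (L * K + K * M) - 2 * r * (q : ℝ) ^ (L * K + K * M) / q := by ring
    linarith
  refine le_trans (mul_le_mul_of_nonneg_right hG (by positivity))
    (sum_distOf_mul_le_H hp _ fun C hC => ?_)
  have hC1 := hsum {C}
  rw [Finset.sum_singleton] at hC1
  simp only [Finset.mem_singleton] at hC1
  rw [hC1, Real.exp_neg, Real.exp_nat_mul, Real.exp_log hq0, div_le_iff₀ (by positivity),
    ← hvw, pow_add, inv_mul_cancel_left₀ (by positivity)]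
  exact_mod_cast hcount C (Finset.mem_filter.mp hC).2

/-- The limit of the normalised entropy of a product of uniform random matrices. -/
def mulDim (L K M : ℕ) : ℕ := if min L M ≤ K then L * M else K * M + (L - K) * K

lemma cast_mulDim (L K M : ℕ) : (mulDim L K M : ℝ) =
    if min L M ≤ K then (L * M : ℝ) else (L * K + K * M - K ^ 2 : ℝ) := by
  unfold mulDim
  split_ifs with h
  · push_cast
    rfl
  · have hKL : K ≤ L := by omega
    push_cast [Nat.cast_sub hKL]
    ring

lemma mulDim_mul_log_le_H_mul {F Ω : Type} [Field F] [Fintype F] [Fintype Ω] {p : Ω → ℝ}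
    (hp : IsPMF p) {L K M : ℕ}
    {A : Ω → Matrix (Fin L) (Fin K) F} {B : Ω → Matrix (Fin K) (Fin M) F}
    (hA : Uniform p A) (hB : Uniform p B) (hAB : IndepRV p A B) :
    (1 - 2 * K / Fintype.card F) * (mulDim L K M * Real.log (Fintype.card F)) ≤
      H p (fun ω => A ω * B ω) := by
  have hlog : 0 ≤ Real.log (Fintype.card F) := Real.log_natCast_nonneg _
  obtain ⟨r, hrK, hr⟩ : ∃ r ≤ K, (1 - 2 * r / Fintype.card F) *
      (mulDim L K M * Real.log (Fintype.card F)) ≤ H p (fun ω => A ω * B ω) := by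
    by_cases h : min L M ≤ K
    · rcases le_total L M with hLM | hLM
      · have hLK : L ≤ K := by omega
        refine ⟨L, hLK, le_H_mul hp hA hB hAB le_rfl hLK hLM (Or.inl rfl)
          (w := L * K + (K - L) * M) ?_
          fun C hC => card_factorizations_le (by omega) hC⟩
        obtain ⟨d, rfl⟩ := Nat.exists_eq_add_of_le hLK
        rw [mulDim, if_pos h, Nat.add_sub_cancel_left]
        ring
      · have hMK : M ≤ K := by omega
        refine ⟨M, hMK, le_H_mul hp hA hB hAB hLM hMK le_rfl (Or.inr (Or.inr rfl))
          (w := M * K + (K - M) * L) ?_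
          fun C hC => card_factorizations_le_of_transpose (by omega) hC⟩
        obtain ⟨d, rfl⟩ := Nat.exists_eq_add_of_le hMK
        rw [mulDim, if_pos h, Nat.add_sub_cancel_left]
        ring
    · have hKL : K ≤ L := by omega
      refine ⟨K, le_rfl, le_H_mul hp hA hB hAB hKL le_rfl (by omega) (Or.inr (Or.inl rfl))
        (w := K * K + (K - K) * M) ?_
        fun C hC => card_factorizations_le (by omega) hC⟩
      obtain ⟨d, rfl⟩ := Nat.exists_eq_add_of_le hKL
      rw [mulDim, if_neg h, Nat.add_sub_cancel_left, Nat.sub_self]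
      ring
  refine le_trans ?_ hr
  gcongr

lemma H_mul_le {F Ω : Type} [Field F] [Fintype F] [Fintype Ω] {p : Ω → ℝ} (hp : IsPMF p)
    {L K M : ℕ} (A : Ω → Matrix (Fin L) (Fin K) F) (B : Ω → Matrix (Fin K) (Fin M) F) :
    H p (fun ω => A ω * B ω) ≤
      L * Real.log 2 + mulDim L K M * Real.log (Fintype.card F) := by
  have hle : (Finset.univ.image
      fun x : Matrix (Fin L) (Fin K) F × Matrix (Fin K) (Fin M) F => x.1 * x.2).card ≤
      2 ^ L * Fintype.card F ^ mulDim L K M := by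
    by_cases h : min L M ≤ K
    · rw [mulDim, if_pos h]
      refine ((Finset.card_le_univ _).trans_eq (card_matrix_fin F L M)).trans
        (Nat.le_mul_of_pos_left _ (by positivity))
    · rw [mulDim, if_neg h]
      exact card_image_mul_le F (by omega)
  have hmem : ∀ ω, A ω * B ω ∈ Finset.univ.image
      fun x : Matrix (Fin L) (Fin K) F × Matrix (Fin K) (Fin M) F => x.1 * x.2 := fun ω =>
    Finset.mem_image.mpr ⟨(A ω, B ω), Finset.mem_univ _, rfl⟩
  have hpos : (Finset.univ.image
      fun x : Matrix (Fin L) (Fin K) F × Matrix (Fin K) (Fin M) F => x.1 * x.2).Nonempty :=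
    Finset.univ_nonempty.image _
  have hq0 : (Fintype.card F : ℝ) ≠ 0 := by exact_mod_cast Fintype.card_ne_zero
  calc _ ≤ _ := H_le_log_card hp _ hmem
    _ ≤ Real.log (2 ^ L * (Fintype.card F : ℝ) ^ mulDim L K M) :=
      Real.log_le_log (by exact_mod_cast hpos.card_pos) (by exact_mod_cast hle)
    _ = _ := by
      rw [Real.log_mul (by positivity) (pow_ne_zero _ hq0), Real.log_pow, Real.log_pow]

end SDMM

/-- **Entropy of a product of uniform random matrices (Lemma 2, eq. (14)).**
For fixed positive `L, K, M` and any `ε > 0`, for all sufficiently large finite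
fields `F` (`|F| = q`): if `A`, `B` are independent, uniformly distributed random
matrices over `F^{L×K}` and `F^{K×M}`, then `H(AB)` in `q`-ary units is within `ε`
of `L·M` when `K ≥ min(L, M)`, and of `L·K + K·M - K²` when `K < min(L, M)`. -/
theorem entropy_matrix_product
    (L K M : ℕ) (hL : 0 < L) (hK : 0 < K) (hM : 0 < M)
    (ε : ℝ) (hε : 0 < ε) :
    ∃ q₀ : ℕ, ∀ (F : Type) [Field F] [Fintype F], q₀ ≤ Fintype.card F →
      ∀ (Ω : Type) [Fintype Ω] (p : Ω → ℝ), SDMM.IsPMF p →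
        ∀ (A : Ω → Matrix (Fin L) (Fin K) F) (B : Ω → Matrix (Fin K) (Fin M) F),
          SDMM.Uniform p A → SDMM.Uniform p B → SDMM.IndepRV p A B →
          |SDMM.H p (fun ω => A ω * B ω) / Real.log (Fintype.card F) -
            (if min L M ≤ K then (L * M : ℝ) else (L * K + K * M - K ^ 2 : ℝ))| < ε := by
  have hlogtop : Filter.Tendsto (fun n : ℕ => L * Real.log 2 / Real.log n) Filter.atTop
      (nhds 0) :=
    (Real.tendsto_log_atTop.comp tendsto_natCast_atTop_atTop).const_div_atTop _
  have hinv : Filter.Tendsto (fun n : ℕ => 2 * K * SDMM.mulDim L K M / (n : ℝ)) Filter.atTop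
      (nhds 0) := tendsto_const_div_atTop_nhds_zero_nat _
  obtain ⟨q₀, hq₀⟩ := Filter.eventually_atTop.mp
    ((hlogtop.eventually_lt_const hε).and (hinv.eventually_lt_const hε))
  refine ⟨q₀, fun F _ _ hF Ω _ p hp A B hA hB hAB => ?_⟩
  obtain ⟨h1, h2⟩ := hq₀ _ hF
  have hlog : 0 < Real.log (Fintype.card F) :=
    Real.log_pos (by exact_mod_cast Fintype.one_lt_card)
  have hlow := SDMM.mulDim_mul_log_le_H_mul hp hA hB hAB
  have hup := SDMM.H_mul_le hp A B
  rw [← SDMM.cast_mulDim, abs_sub_lt_iff]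
  constructor
  · rw [← div_le_div_iff_of_pos_right hlog, add_div, mul_div_cancel_right₀ _ hlog.ne'] at hup
    linarith
  · rw [← mul_assoc, ← le_div_iff₀ hlog] at hlow
    have hring : (1 - 2 * K / (Fintype.card F : ℝ)) * SDMM.mulDim L K M =
        SDMM.mulDim L K M - 2 * K * SDMM.mulDim L K M / (Fintype.card F : ℝ) := by ring
    linarith
end
end

section
/- Fix positive integers L, K, M. For every ε > 0 there exists q₀ such that for every finite field F with |F| = q ≥ q₀ the following holds: if A and B are independent random matrices, with A uniformly distributed on F^{L×K} and B uniformly distributed on F^{K×M}, then |H(AB | A)/log q − min(L·M, K·M)| < ε. -/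
open scoped BigOperators Classical

noncomputable section

namespace SDMM

section Entropy

variable {Ω : Type} {α β γ : Type*} [Fintype Ω] [Fintype α] [Fintype β]

/-- The law of a function of `Z` is the push-forward of the law of `Z`. -/
theorem distOf_comp (p : Ω → ℝ) (Z : Ω → α) (g : α → γ) (c : γ) :
    distOf p (fun ω => g (Z ω)) c = ∑ z, if g z = c then distOf p Z z else 0 := by
  simp only [distOf]
  rw [← Finset.sum_filter (fun z => g z = c), Finset.sum_comm]
  simp

theorem distOf_prodMk_of_uniform {p : Ω → ℝ} {X : Ω → α} {Y : Ω → β}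
    (hX : Uniform p X) (hY : Uniform p Y) (hXY : IndepRV p X Y) (f : α → β → γ) (c : γ) (a : α) :
    distOf p (fun ω => (f (X ω) (Y ω), X ω)) (c, a) =
      (Finset.univ.filter fun b => f a b = c).card / (Fintype.card α * Fintype.card β : ℝ) := by
  rw [distOf_comp p (fun ω => (X ω, Y ω)) (fun z => (f z.1 z.2, z.1)), Fintype.sum_prod_type]
  rw [Finset.sum_eq_single a (fun a' _ h => by simp [h]) (by simp)]
  simp only [Prod.mk.injEq, and_true, hXY a, hX a, hY _]
  rw [← Finset.sum_filter, Finset.sum_const, nsmul_eq_mul]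
  field_simp

theorem entropy_of_uniform [Nonempty α] {p : Ω → ℝ} {X : Ω → α}
    (hX : Uniform p X) : H p X = Real.log (Fintype.card α) := by
  have hα : (Fintype.card α : ℝ) ≠ 0 := by simp
  simp only [H, hX _, Real.negMulLog, Finset.sum_const, Finset.card_univ, nsmul_eq_mul, one_div,
    Real.log_inv]
  field_simp

/-- All nonempty fibres of a homomorphism of finite groups have the same size, so the weights
`|f⁻¹ c| / (n |G|)` take the value `1 / (n |range f|)` on `range f` and vanish elsewhere. -/
theorem sum_negMulLog_card_fiber {G G' : Type*} [AddGroup G] [Fintype G] [AddGroup G'] [Fintype G']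
    (f : G →+ G') {n : ℝ} (hn : 0 < n) :
    ∑ c, Real.negMulLog ((Finset.univ.filter fun b => f b = c).card / (n * Fintype.card G)) =
      (Real.log n + Real.log (Nat.card f.range)) / n := by
  set k := (Finset.univ.filter fun b => f b = 0).card with hk
  set R := Finset.univ.filter fun c => c ∈ f.range with hR
  have hRcard : R.card = Nat.card f.range := by
    rw [Nat.card_eq_fintype_card, Fintype.card_subtype]
  have hfib : ∀ c ∈ R, (Finset.univ.filter fun b => f b = c).card = k := fun c hc =>
    AddMonoidHom.card_fiber_eq_of_mem_range f (by simpa [hR] using hc) ⟨0, map_zero f⟩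
  have hempty : ∀ c ∉ R, (Finset.univ.filter fun b => f b = c).card = 0 := fun c hc => by
    simp only [Finset.card_eq_zero, Finset.filter_eq_empty_iff]
    rintro b - rfl
    exact hc (by simp [hR])
  have hcard : Fintype.card G = R.card * k := by
    rw [← Finset.card_univ, Finset.card_eq_sum_card_fiberwise (f := f) (t := R)
      (fun b _ => by simp [hR]), Finset.sum_congr rfl hfib, Finset.sum_const, smul_eq_mul]
  have hpos : 0 < R.card * k := hcard ▸ Fintype.card_pos
  have hk0 : (k : ℝ) ≠ 0 := by exact_mod_cast (Nat.pos_of_mul_pos_left hpos).ne'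
  have hR0 : (R.card : ℝ) ≠ 0 := by exact_mod_cast (Nat.pos_of_mul_pos_right hpos).ne'
  have hw : (k : ℝ) / (n * (R.card * k)) = (n * R.card)⁻¹ := by field_simp
  rw [← Finset.sum_subset R.subset_univ fun c _ hc => by simp [hempty c hc],
    Finset.sum_congr rfl fun c hc => by rw [hfib c hc], Finset.sum_const, nsmul_eq_mul, hcard,
    Nat.cast_mul, hw, Real.negMulLog, Real.log_inv, Real.log_mul hn.ne' hR0, hRcard]
  rw [hRcard] at hR0
  field_simp

/-- If `X` and `Y` are independent and uniform, then given `X = a` the variable `f X Y` is uniform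
on the range of `f a`. -/
theorem condEntropy_hom_of_uniform [Nonempty α] {G G' : Type*} [AddGroup G]
    [Fintype G] [AddGroup G'] [Fintype G'] {p : Ω → ℝ} {X : Ω → α} {Y : Ω → G}
    (hX : Uniform p X) (hY : Uniform p Y) (hXY : IndepRV p X Y) (f : α → G →+ G') :
    Hc p (fun ω => f (X ω) (Y ω)) X =
      (∑ a, Real.log (Nat.card (f a).range)) / Fintype.card α := by
  have hα : (0 : ℝ) < Fintype.card α := by exact_mod_cast Fintype.card_pos
  rw [Hc, entropy_of_uniform hX, H, Fintype.sum_prod_type_right]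
  simp only [distOf_prodMk_of_uniform hX hY hXY (fun a b => f a b), sum_negMulLog_card_fiber _ hα]
  rw [← Finset.sum_div, Finset.sum_add_distrib, Finset.sum_const, Finset.card_univ, nsmul_eq_mul]
  field_simp
  ring

end Entropy

section Rank

variable {F : Type*} [Field F] [Fintype F]

theorem card_range_mulLeft {l k m : Type*} [Fintype l] [Fintype k] [Fintype m]
    (A : Matrix l k F) :
    Nat.card (AddMonoidHom.range
      (Matrix.addMonoidHomMulLeft A : Matrix k m F →+ Matrix l m F)) =
      Fintype.card F ^ (A.rank * Fintype.card m) := by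
  have e : AddMonoidHom.range (Matrix.addMonoidHomMulLeft A : Matrix k m F →+ Matrix l m F) ≃
      (m → LinearMap.range A.mulVecLin) :=
    { toFun := fun C j => ⟨C.1.col j, by
        obtain ⟨_, B, rfl⟩ := C
        exact ⟨B.col j, rfl⟩⟩
      invFun := fun v => ⟨Matrix.of fun i j => (v j).1 i, by
        choose w hw using fun j => (v j).2
        refine ⟨Matrix.of fun i j => w j i, ?_⟩
        ext i j
        exact congrFun (hw j) i⟩
      left_inv := fun C => rfl
      right_inv := fun v => rfl }
  rw [Nat.card_congr e, Nat.card_fun, Module.natCard_eq_pow_finrank (K := F), pow_mul,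
    Nat.card_eq_fintype_card, Nat.card_eq_fintype_card, Matrix.rank]

theorem card_linearIndependent_ge {k n : ℕ} (hkn : k ≤ n) :
    (Fintype.card F : ℝ) ^ (k * n) * (1 - k / Fintype.card F) ≤
      Nat.card {s : Fin k → Fin n → F // LinearIndependent F s} := by
  have hq : (1 : ℝ) < Fintype.card F := by exact_mod_cast Fintype.one_lt_card
  have hq0 : (0 : ℝ) < Fintype.card F := by linarith
  have hinv : (Fintype.card F : ℝ)⁻¹ ≤ 1 := inv_le_one_of_one_le₀ hq.le
  rw [card_linearIndependent (K := F) (V := Fin n → F) (by simpa using hkn), Nat.cast_prod]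
  calc (Fintype.card F : ℝ) ^ (k * n) * (1 - k / Fintype.card F)
      ≤ (Fintype.card F : ℝ) ^ (k * n) * (1 + -(Fintype.card F : ℝ)⁻¹) ^ k := by
        gcongr
        refine le_trans (le_of_eq ?_) (one_add_mul_le_pow (by linarith) k)
        ring
    _ = ∏ _i : Fin k, (Fintype.card F : ℝ) ^ n * (1 + -(Fintype.card F : ℝ)⁻¹) := by
        simp [mul_pow, ← pow_mul, mul_comm]
    _ ≤ _ := by
        refine Finset.prod_le_prod (fun i _ => mul_nonneg (by positivity) (by linarith))
          fun i _ => ?_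
        have hin : (i : ℕ) + 1 ≤ n := by omega
        rw [Module.finrank_fin_fun, Nat.cast_sub (Nat.pow_le_pow_right Fintype.card_pos (by omega))]
        push_cast
        have : (Fintype.card F : ℝ) ^ (i : ℕ) * Fintype.card F ≤ (Fintype.card F : ℝ) ^ n := by
          rw [← pow_succ]
          exact pow_le_pow_right₀ hq.le hin
        rw [← le_div_iff₀ hq0] at this
        rw [div_eq_mul_inv] at this
        linarith

/-- All but a fraction `min L K / |F|` of the `L × K` matrices have full rank. -/
theorem card_rank_eq_min_ge (L K : ℕ) :
    (Fintype.card (Matrix (Fin L) (Fin K) F) : ℝ) * (1 - min (L : ℝ) K / Fintype.card F) ≤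
      (Finset.univ.filter fun A : Matrix (Fin L) (Fin K) F => A.rank = min L K).card := by
  have hcard : (Fintype.card (Matrix (Fin L) (Fin K) F) : ℝ) = (Fintype.card F : ℝ) ^ (L * K) := by
    rw [Module.card_eq_pow_finrank (K := F), Module.finrank_matrix]
    simp
  rw [hcard, ← Fintype.card_subtype,
    ← Nat.card_eq_fintype_card (α := {A : Matrix (Fin L) (Fin K) F // A.rank = min L K})]
  rcases le_total L K with h | h
  · rw [min_eq_left (by exact_mod_cast h)]
    refine (card_linearIndependent_ge (F := F) h).trans (Nat.cast_le.mpr ?_)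
    refine Nat.card_le_card_of_injective
      (fun s => ⟨Matrix.of s.1, ?_⟩)
      fun s t hst => Subtype.ext (Matrix.of.injective (Subtype.mk.inj hst))
    rw [LinearIndependent.rank_matrix (M := Matrix.of s.1) s.2, Fintype.card_fin, min_eq_left h]
  · rw [min_eq_right (by exact_mod_cast h), mul_comm L K]
    refine (card_linearIndependent_ge (F := F) h).trans (Nat.cast_le.mpr ?_)
    refine Nat.card_le_card_of_injective
      (fun s => ⟨(Matrix.of s.1).transpose, ?_⟩)
      fun s t hst => Subtype.ext (Matrix.transpose_injective (congrArg Subtype.val hst))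
    rw [Matrix.rank_transpose, LinearIndependent.rank_matrix (M := Matrix.of s.1) s.2,
      Fintype.card_fin, min_eq_right h]

theorem sum_rank_le (L K : ℕ) :
    (∑ A : Matrix (Fin L) (Fin K) F, (A.rank : ℝ)) ≤
      Fintype.card (Matrix (Fin L) (Fin K) F) * min (L : ℝ) K := by
  rw [← nsmul_eq_mul, ← Finset.card_univ]
  refine Finset.sum_le_card_nsmul _ _ _ fun A _ => ?_
  exact_mod_cast le_min A.rank_le_height A.rank_le_width

theorem le_sum_rank (L K : ℕ) :
    Fintype.card (Matrix (Fin L) (Fin K) F) * (1 - min (L : ℝ) K / Fintype.card F) *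
      min (L : ℝ) K ≤ ∑ A : Matrix (Fin L) (Fin K) F, (A.rank : ℝ) := by
  calc _ ≤ ((Finset.univ.filter fun A : Matrix (Fin L) (Fin K) F => A.rank = min L K).card : ℝ) *
        min (L : ℝ) K := by
        gcongr
        exact card_rank_eq_min_ge L K
    _ = ∑ A with Matrix.rank (A : Matrix (Fin L) (Fin K) F) = min L K, (A.rank : ℝ) := by
        rw [← Nat.cast_min, ← nsmul_eq_mul, ← Finset.sum_const]
        exact Finset.sum_congr rfl fun A hA => by rw [(Finset.mem_filter.mp hA).2]
    _ ≤ _ := Finset.sum_le_sum_of_subset_of_nonneg (Finset.subset_univ _)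
        fun _ _ _ => Nat.cast_nonneg _

end Rank

/-- In `|F|`-ary units, `H(AB | A)` is `M` times the mean rank of `A`. -/
theorem condEntropy_mul_left {L K M : ℕ} {F : Type*} [Field F] [Fintype F] {Ω : Type} [Fintype Ω]
    {p : Ω → ℝ} {A : Ω → Matrix (Fin L) (Fin K) F} {B : Ω → Matrix (Fin K) (Fin M) F}
    (hA : Uniform p A) (hB : Uniform p B) (hAB : IndepRV p A B) :
    Hc p (fun ω => A ω * B ω) A / Real.log (Fintype.card F) =
      M * ((∑ a : Matrix (Fin L) (Fin K) F, (a.rank : ℝ)) /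
        Fintype.card (Matrix (Fin L) (Fin K) F)) := by
  have hlog : Real.log (Fintype.card F) ≠ 0 :=
    (Real.log_pos (by exact_mod_cast Fintype.one_lt_card)).ne'
  have h := condEntropy_hom_of_uniform hA hB hAB fun a => Matrix.addMonoidHomMulLeft a
  simp only [Matrix.addMonoidHomMulLeft_apply, card_range_mulLeft, Fintype.card_fin, Nat.cast_pow,
    Real.log_pow, Nat.cast_mul, mul_assoc, ← Finset.sum_mul] at h
  rw [h]
  field_simp

end SDMM

/-- **Conditional entropy `H(AB | A)` (Lemma 2, eq. (15)).**
For fixed positive `L, K, M` and any `ε > 0`, for all sufficiently large finite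
fields `F` (`|F| = q`): if `A`, `B` are independent, uniformly distributed random
matrices over `F^{L×K}` and `F^{K×M}`, then `H(AB | A)` in `q`-ary units is within
`ε` of `min(L·M, K·M)`. -/
theorem cond_entropy_matrix_product_given_left
    (L K M : ℕ) (hL : 0 < L) (hK : 0 < K) (hM : 0 < M)
    (ε : ℝ) (hε : 0 < ε) :
    ∃ q₀ : ℕ, ∀ (F : Type) [Field F] [Fintype F], q₀ ≤ Fintype.card F →
      ∀ (Ω : Type) [Fintype Ω] (p : Ω → ℝ), SDMM.IsPMF p →
        ∀ (A : Ω → Matrix (Fin L) (Fin K) F) (B : Ω → Matrix (Fin K) (Fin M) F),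
          SDMM.Uniform p A → SDMM.Uniform p B → SDMM.IndepRV p A B →
          |SDMM.Hc p (fun ω => A ω * B ω) A / Real.log (Fintype.card F) -
            (min (L * M) (K * M) : ℝ)| < ε := by
  obtain ⟨q₀, hq₀⟩ := exists_nat_gt ((M : ℝ) * min (L : ℝ) K * min (L : ℝ) K / ε)
  refine ⟨q₀, fun F _ _ hF Ω _ p _ A B hA hB hAB => ?_⟩
  have hN : (0 : ℝ) < Fintype.card (Matrix (Fin L) (Fin K) F) := by
    exact_mod_cast Fintype.card_pos
  have hq : (0 : ℝ) < Fintype.card F := by exact_mod_cast Fintype.card_pos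
  have hM' : (0 : ℝ) < M := by exact_mod_cast hM
  have hsmall : (M : ℝ) * min (L : ℝ) K * min (L : ℝ) K / Fintype.card F < ε := by
    rw [div_lt_iff₀ hq, mul_comm ε, ← div_lt_iff₀ hε]
    exact hq₀.trans_le (by exact_mod_cast hF)
  rw [SDMM.condEntropy_mul_left hA hB hAB, ← min_mul_of_nonneg _ _ hM'.le]
  have hupper := SDMM.sum_rank_le (F := F) L K
  have hlower := SDMM.le_sum_rank (F := F) L K
  rw [mul_comm, ← div_le_iff₀ hN] at hupper
  rw [mul_assoc, mul_comm, ← le_div_iff₀ hN] at hlower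
  have hupper' := mul_le_mul_of_nonneg_left hupper hM'.le
  have hlower' := mul_le_mul_of_nonneg_left hlower hM'.le
  have hexpand : (M : ℝ) * ((1 - min (L : ℝ) K / Fintype.card F) * min (L : ℝ) K) =
      min (L : ℝ) K * M - M * min (L : ℝ) K * min (L : ℝ) K / Fintype.card F := by ring
  rw [abs_lt]
  constructor <;> linarith
end
end

section
/- Consider an MM-XSTPIR scheme with N servers, K messages, security level X, privacy level T, and retrieval-set size M, where N > X + T and 1 ≤ M ≤ K. Then Σ_{n=1}^{N} D_n ≥ M·ℓ · (N/(N − X)) · Σ_{j=0}^{⌊K/M⌋ − 1} (T/(N − X))^j. In particular, the retrieval rate Mℓ / Σ_n D_n is at most ((N − X)/N) · (1 + (T/(N−X)) + ⋯ + (T/(N−X))^{⌊K/M⌋−1})^{−1}. -/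
open scoped BigOperators Classical

noncomputable section

namespace SDMM

section Lattice

variable {L : Type*} [SemilatticeInf L] [OrderTop L]

/-- An abstract entropy function on a meet-semilattice, in which `x ⊓ y` plays the role of the joint
random variable `(X, Y)`. -/
structure IsEntropic (h : L → ℝ) : Prop where
  map_top : h ⊤ = 0
  anti : Antitone h
  submod : ∀ {r s u : L}, r ≤ u → s ≤ u → h (r ⊓ s) + h u ≤ h r + h s

namespace IsEntropic

variable {h : L → ℝ}

lemma submod_le (hh : IsEntropic h) {r s t u : L} (ht : r ⊓ s ≤ t) (hr : r ≤ u) (hs : s ≤ u) :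
    h t + h u ≤ h r + h s := by
  linarith [hh.submod hr hs, hh.anti ht]

lemma nonneg (hh : IsEntropic h) (x : L) : 0 ≤ h x := by
  linarith [hh.map_top, hh.anti (le_top : x ≤ ⊤)]

lemma inf_le_add (hh : IsEntropic h) (x y : L) : h (x ⊓ y) ≤ h x + h y := by
  linarith [hh.map_top, hh.submod (le_top : x ≤ ⊤) (le_top : y ≤ ⊤)]

lemma inf_le_sum (hh : IsEntropic h) {ι : Type*} (U : Finset ι) (f : ι → L) :
    h (U.inf f) ≤ ∑ i ∈ U, h (f i) := by
  induction U using Finset.induction_on with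
  | empty => simp [hh.map_top]
  | insert i U hi ih =>
    rw [Finset.inf_insert, Finset.sum_insert hi]
    linarith [hh.inf_le_add (f i) (U.inf f)]

/-- Independence passes to coarser variables. -/
lemma indep_mono (hh : IsEntropic h) {x y x' y' : L} (hxy : h (x ⊓ y) = h x + h y)
    (hx : x ≤ x') (hy : y ≤ y') : h (x' ⊓ y') = h x' + h y' := by
  have h₁ := hh.submod_le (r := x ⊓ y') (s := y) (t := x ⊓ y) (u := y')
    (by order) inf_le_right hy
  have h₂ := hh.submod_le (r := x' ⊓ y') (s := x) (t := x ⊓ y') (u := x')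
    (by order) inf_le_left hx
  linarith [hh.inf_le_add x' y']

/-- If `y` is determined by `x`, then it is determined by anything finer than `x`. -/
lemma determined_mono (hh : IsEntropic h) {x y x' : L} (hxy : h (x ⊓ y) = h x) (hx : x' ≤ x) :
    h (x' ⊓ y) = h x' := by
  have h₁ := hh.submod_le (r := x') (s := x ⊓ y) (t := x' ⊓ y) (u := x)
    (by order) hx inf_le_left
  linarith [hh.anti (inf_le_left : x' ⊓ y ≤ x')]

lemma determined_inf (hh : IsEntropic h) {ι : Type*} {x : L} {f : ι → L} (U : Finset ι)
    (hf : ∀ i ∈ U, h (x ⊓ f i) = h x) : h (x ⊓ U.inf f) = h x := by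
  induction U using Finset.induction_on with
  | empty => simp
  | insert i U hi ih =>
    have ih' := ih fun j hj => hf j (Finset.mem_insert_of_mem hj)
    have h₁ := hh.determined_mono (hf i (Finset.mem_insert_self i U))
      (inf_le_left : x ⊓ U.inf f ≤ x)
    rw [Finset.inf_insert, inf_comm (f i), ← inf_assoc, h₁, ih']

/-- Conditional entropy of a family of variables has total marginal increments at most its value. -/
lemma sum_marginal_le (hh : IsEntropic h) {ι : Type*} [DecidableEq ι] (f : ι → L) (z : L)
    (V : Finset ι) :
    ∑ i ∈ V, ((h (V.inf f ⊓ z) - h z) - (h ((V.erase i).inf f ⊓ z) - h z)) ≤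
      h (V.inf f ⊓ z) - h z := by
  suffices ∀ U ⊆ V, ∑ i ∈ U, ((h (V.inf f ⊓ z) - h z) - (h ((V.erase i).inf f ⊓ z) - h z)) ≤
      h (U.inf f ⊓ z) - h z from this V subset_rfl
  intro U
  induction U using Finset.induction_on with
  | empty => simp
  | insert i U hi ih =>
    intro hU
    have hiV : i ∈ V := hU (Finset.mem_insert_self i U)
    have hUV : U ⊆ V := (Finset.subset_insert i U).trans hU
    have hUe : (V.erase i).inf f ≤ U.inf f :=
      Finset.inf_mono fun j hj => Finset.mem_erase.2 ⟨fun e => hi (e ▸ hj), hUV hj⟩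
    have hV : V.inf f = f i ⊓ (V.erase i).inf f := by
      rw [← Finset.inf_insert, Finset.insert_erase hiV]
    rw [Finset.sum_insert hi, Finset.inf_insert]
    have h₁ := hh.submod_le (r := f i ⊓ U.inf f ⊓ z) (s := (V.erase i).inf f ⊓ z)
      (t := V.inf f ⊓ z) (u := U.inf f ⊓ z) (by rw [hV]; order) (by order) (by order)
    linarith [ih hUV]

end IsEntropic

/-- A set function whose total marginal decrements never exceed its value has, among the subsets of
each size, one carrying at least the proportional share. -/
lemma exists_subset_proportional {ι : Type*} [DecidableEq ι] (g : Finset ι → ℝ)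
    (hg : ∀ V, ∑ i ∈ V, (g V - g (V.erase i)) ≤ g V) (t : ℕ) (V : Finset ι) (ht : t ≤ V.card) :
    ∃ U ⊆ V, U.card = t ∧ (t : ℝ) * g V ≤ V.card * g U := by
  rcases Nat.eq_zero_or_pos t with rfl | htpos
  · refine ⟨∅, by simp, by simp, ?_⟩
    have := hg ∅
    simp only [Finset.sum_empty] at this
    simp only [Nat.cast_zero, zero_mul]
    positivity
  induction hn : V.card - t generalizing V with
  | zero => exact ⟨V, subset_rfl, by omega, by rw [show V.card = t by omega]⟩
  | succ d ih =>
    have hne : V.Nonempty := Finset.card_pos.1 (by omega)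
    obtain ⟨i, hi, hle⟩ : ∃ i ∈ V, (V.card : ℝ) * (g V - g (V.erase i)) ≤ g V := by
      by_contra! hcon
      have h₁ := Finset.sum_lt_sum_of_nonempty hne hcon
      rw [← Finset.mul_sum, Finset.sum_const, nsmul_eq_mul] at h₁
      have h₂ := mul_le_mul_of_nonneg_left (hg V) (Nat.cast_nonneg (α := ℝ) V.card)
      linarith
    have hcard := Finset.card_erase_of_mem hi
    obtain ⟨U, hU, hUt, hUle⟩ := ih (V.erase i) (by omega) (by omega)
    refine ⟨U, hU.trans (Finset.erase_subset i V), hUt, ?_⟩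
    have hc : ((V.erase i).card : ℝ) = V.card - 1 := by
      rw [hcard, Nat.cast_sub (by omega), Nat.cast_one]
    rw [hc] at hUle
    have hpos : (0 : ℝ) < V.card - 1 := by
      have : (1 : ℝ) < V.card := by exact_mod_cast (by omega : 1 < V.card)
      linarith
    have ht0 : (0 : ℝ) ≤ t := Nat.cast_nonneg t
    have hV0 : (0 : ℝ) ≤ V.card := Nat.cast_nonneg _
    refine le_of_mul_le_mul_left ?_ hpos
    have h₁ := mul_le_mul_of_nonneg_left hle ht0
    have h₂ := mul_le_mul_of_nonneg_left hUle hV0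
    linarith

/-- The entropic form of an MM-XSTPIR scheme: messages `w`, storage `s`, queries `q` and answers `a`
are elements of a meet-semilattice carrying an abstract entropy function `h`. -/
structure IsScheme (h : L → ℝ) {N K : ℕ} (X T M : ℕ) (ℓ : ℝ) (w : Fin K → L) (s : Fin N → L)
    (q a : Finset (Fin K) → Fin N → L) : Prop where
  entropic : IsEntropic h
  message : ∀ k, h (w k) = ℓ
  messages : h (Finset.univ.inf w) = ∑ k, h (w k)
  storage : h (Finset.univ.inf s ⊓ Finset.univ.inf w) = h (Finset.univ.inf s)
  secure : ∀ 𝒳 : Finset (Fin N), 𝒳.card = X →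
    h (𝒳.inf s ⊓ Finset.univ.inf w) = h (𝒳.inf s) + h (Finset.univ.inf w)
  query : ∀ 𝒦 : Finset (Fin K), 𝒦.card = M →
    h (Finset.univ.inf s ⊓ Finset.univ.inf (q 𝒦)) =
      h (Finset.univ.inf s) + h (Finset.univ.inf (q 𝒦))
  answer : ∀ 𝒦 : Finset (Fin K), 𝒦.card = M → ∀ n, h ((q 𝒦 n ⊓ s n) ⊓ a 𝒦 n) = h (q 𝒦 n ⊓ s n)
  correct : ∀ 𝒦 : Finset (Fin K), 𝒦.card = M →
    h ((Finset.univ.inf (a 𝒦) ⊓ Finset.univ.inf (q 𝒦)) ⊓ 𝒦.inf w) =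
      h (Finset.univ.inf (a 𝒦) ⊓ Finset.univ.inf (q 𝒦))
  private_answer : ∀ 𝒯 : Finset (Fin N), 𝒯.card ≤ T → ∀ 𝒦 𝒦' : Finset (Fin K),
    𝒦.card = M → 𝒦'.card = M → ∀ (𝒳 : Finset (Fin N)) (C : Finset (Fin K)),
      h (𝒯.inf (a 𝒦) ⊓ (𝒳.inf s ⊓ 𝒯.inf (q 𝒦) ⊓ C.inf w)) =
        h (𝒯.inf (a 𝒦') ⊓ (𝒳.inf s ⊓ 𝒯.inf (q 𝒦') ⊓ C.inf w))
  private_query : ∀ 𝒯 : Finset (Fin N), 𝒯.card ≤ T → ∀ 𝒦 𝒦' : Finset (Fin K),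
    𝒦.card = M → 𝒦'.card = M → ∀ (𝒳 : Finset (Fin N)) (C : Finset (Fin K)),
      h (𝒳.inf s ⊓ 𝒯.inf (q 𝒦) ⊓ C.inf w) = h (𝒳.inf s ⊓ 𝒯.inf (q 𝒦') ⊓ C.inf w)

namespace IsScheme

variable {h : L → ℝ} {N K X T M : ℕ} {ℓ : ℝ} {w : Fin K → L} {s : Fin N → L}
  {q a : Finset (Fin K) → Fin N → L}

lemma messages_eq (hs : IsScheme h X T M ℓ w s q a) (B : Finset (Fin K)) :
    h (B.inf w) = B.card * ℓ := by
  have h₁ := hs.entropic.inf_le_sum B w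
  have h₂ := hs.entropic.inf_le_sum Bᶜ w
  have h₃ := hs.entropic.inf_le_add (B.inf w) (Bᶜ.inf w)
  rw [← Finset.inf_union, Finset.union_compl, hs.messages, ← Finset.sum_add_sum_compl B] at h₃
  have h₄ : ∑ k ∈ B, h (w k) = B.card * ℓ := by simp [hs.message]
  linarith

/-- The queries are independent of storage and messages together. -/
lemma query_indep (hs : IsScheme h X T M ℓ w s q a) {𝒦 : Finset (Fin K)} (h𝒦 : 𝒦.card = M)
    (𝒯 𝒳 : Finset (Fin N)) (C : Finset (Fin K)) :
    h (𝒳.inf s ⊓ 𝒯.inf (q 𝒦) ⊓ C.inf w) = h (𝒳.inf s ⊓ C.inf w) + h (𝒯.inf (q 𝒦)) := by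
  have h₁ : h ((Finset.univ.inf s ⊓ Finset.univ.inf w) ⊓ Finset.univ.inf (q 𝒦)) =
      h (Finset.univ.inf s ⊓ Finset.univ.inf w) + h (Finset.univ.inf (q 𝒦)) := by
    rw [inf_right_comm, hs.entropic.determined_mono hs.storage inf_le_left, hs.storage,
      hs.query 𝒦 h𝒦]
  rw [inf_right_comm]
  exact hs.entropic.indep_mono h₁
    (inf_le_inf (Finset.inf_mono (Finset.subset_univ _)) (Finset.inf_mono (Finset.subset_univ _)))
    (Finset.inf_mono (Finset.subset_univ _))

lemma storage_indep (hs : IsScheme h X T M ℓ w s q a) {𝒳 : Finset (Fin N)} (h𝒳 : 𝒳.card = X)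
    (C : Finset (Fin K)) : h (𝒳.inf s ⊓ C.inf w) = h (𝒳.inf s) + C.card * ℓ := by
  rw [← hs.messages_eq]
  exact hs.entropic.indep_mono (hs.secure 𝒳 h𝒳) le_rfl (Finset.inf_mono (Finset.subset_univ _))

lemma answers_determined (hs : IsScheme h X T M ℓ w s q a) {𝒦 : Finset (Fin K)}
    (h𝒦 : 𝒦.card = M) (𝒯 : Finset (Fin N)) {x : L} (hx : x ≤ 𝒯.inf s ⊓ 𝒯.inf (q 𝒦)) :
    h (x ⊓ 𝒯.inf (a 𝒦)) = h x :=
  hs.entropic.determined_inf 𝒯 fun n hn => hs.entropic.determined_mono (hs.answer 𝒦 h𝒦 n)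
    (hx.trans (le_inf (inf_le_right.trans (Finset.inf_le hn))
      (inf_le_left.trans (Finset.inf_le hn))))

/-- Entropy of the answers from the servers outside `𝒳`, given the storage at `𝒳`, all queries and
the messages in `C`. -/
def residual (h : L → ℝ) (w : Fin K → L) (s : Fin N → L) (q a : Finset (Fin K) → Fin N → L)
    (𝒳 : Finset (Fin N)) (𝒦 C : Finset (Fin K)) : ℝ :=
  h (𝒳ᶜ.inf (a 𝒦) ⊓ (𝒳.inf s ⊓ Finset.univ.inf (q 𝒦) ⊓ C.inf w)) -
    h (𝒳.inf s ⊓ Finset.univ.inf (q 𝒦) ⊓ C.inf w)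

lemma residual_nonneg (hs : IsScheme h X T M ℓ w s q a) (𝒳 : Finset (Fin N))
    (𝒦 C : Finset (Fin K)) : 0 ≤ residual h w s q a 𝒳 𝒦 C :=
  sub_nonneg.2 (hs.entropic.anti inf_le_right)

/-- Decoding `𝒦` extracts `Mℓ` from the residual entropy. -/
lemma residual_eq (hs : IsScheme h X T M ℓ w s q a) {𝒳 : Finset (Fin N)} (h𝒳 : 𝒳.card = X)
    {𝒦 C : Finset (Fin K)} (h𝒦 : 𝒦.card = M) (hC : Disjoint C 𝒦) :
    residual h w s q a 𝒳 𝒦 C = M * ℓ + residual h w s q a 𝒳 𝒦 (C ∪ 𝒦) := by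
  have hq : Finset.univ.inf (q 𝒦) ≤ 𝒳.inf (q 𝒦) := Finset.inf_mono (Finset.subset_univ _)
  set z := 𝒳ᶜ.inf (a 𝒦) ⊓ (𝒳.inf s ⊓ Finset.univ.inf (q 𝒦) ⊓ C.inf w) with hz
  have hdet : h (z ⊓ 𝒳.inf (a 𝒦)) = h z :=
    hs.answers_determined h𝒦 𝒳 (by rw [hz]; order)
  have huniv : Finset.univ.inf (a 𝒦) = 𝒳.inf (a 𝒦) ⊓ 𝒳ᶜ.inf (a 𝒦) := by
    rw [← Finset.inf_union, Finset.union_compl]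
  have hdec : h (z ⊓ 𝒳.inf (a 𝒦) ⊓ 𝒦.inf w) = h (z ⊓ 𝒳.inf (a 𝒦)) :=
    hs.entropic.determined_mono (hs.correct 𝒦 h𝒦) (by rw [huniv, hz]; order)
  have hz𝒦 : h (z ⊓ 𝒦.inf w) = h z :=
    le_antisymm ((hs.entropic.anti (by order)).trans (hdec.trans hdet).le)
      (hs.entropic.anti inf_le_left)
  have hjoin : 𝒳ᶜ.inf (a 𝒦) ⊓ (𝒳.inf s ⊓ Finset.univ.inf (q 𝒦) ⊓ (C ∪ 𝒦).inf w) =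
      z ⊓ 𝒦.inf w := by
    rw [Finset.inf_union, hz]; ac_rfl
  rw [residual, residual, hjoin, hz𝒦, hs.query_indep h𝒦, hs.query_indep h𝒦, hs.storage_indep h𝒳,
    hs.storage_indep h𝒳, Finset.card_union_of_disjoint hC, h𝒦]
  push_cast
  ring

/-- Given the queries at `𝒯`, the remaining queries do not reduce the entropy of the answers at `𝒯`. -/
lemma conditional_answers_le (hs : IsScheme h X T M ℓ w s q a) {𝒦 : Finset (Fin K)}
    (h𝒦 : 𝒦.card = M) (𝒯 𝒳 : Finset (Fin N)) (C : Finset (Fin K)) :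
    h (𝒯.inf (a 𝒦) ⊓ (𝒳.inf s ⊓ 𝒯.inf (q 𝒦) ⊓ C.inf w)) -
        h (𝒳.inf s ⊓ 𝒯.inf (q 𝒦) ⊓ C.inf w) ≤
      h (𝒯.inf (a 𝒦) ⊓ (𝒳.inf s ⊓ Finset.univ.inf (q 𝒦) ⊓ C.inf w)) -
        h (𝒳.inf s ⊓ Finset.univ.inf (q 𝒦) ⊓ C.inf w) := by
  have hq : Finset.univ.inf (q 𝒦) ≤ 𝒯.inf (q 𝒦) := Finset.inf_mono (Finset.subset_univ _)
  have hsX : Finset.univ.inf s ≤ 𝒳.inf s := Finset.inf_mono (Finset.subset_univ _)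
  have hsT : Finset.univ.inf s ≤ 𝒯.inf s := Finset.inf_mono (Finset.subset_univ _)
  have hw : Finset.univ.inf w ≤ C.inf w := Finset.inf_mono (Finset.subset_univ _)
  have h₁ := hs.entropic.submod_le
    (r := 𝒯.inf (a 𝒦) ⊓ (𝒳.inf s ⊓ Finset.univ.inf (q 𝒦) ⊓ C.inf w))
    (s := Finset.univ.inf s ⊓ 𝒯.inf (q 𝒦) ⊓ Finset.univ.inf w ⊓ 𝒯.inf (a 𝒦))
    (t := Finset.univ.inf s ⊓ Finset.univ.inf (q 𝒦) ⊓ Finset.univ.inf w)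
    (u := 𝒯.inf (a 𝒦) ⊓ (𝒳.inf s ⊓ 𝒯.inf (q 𝒦) ⊓ C.inf w))
    (by order) (by order) (by order)
  rw [hs.answers_determined h𝒦 𝒯 (by order)] at h₁
  simp only [hs.query_indep h𝒦] at h₁ ⊢
  linarith

/-- Privacy passes a `T / (N - X)` share of the residual entropy on to another retrieval set. -/
lemma residual_private (hs : IsScheme h X T M ℓ w s q a) (hNXT : X + T < N)
    {𝒳 : Finset (Fin N)} (h𝒳 : 𝒳.card = X) {𝒦 𝒦' : Finset (Fin K)} (h𝒦 : 𝒦.card = M)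
    (h𝒦' : 𝒦'.card = M) (C : Finset (Fin K)) :
    (T : ℝ) / ((N : ℝ) - X) * residual h w s q a 𝒳 𝒦' C ≤ residual h w s q a 𝒳 𝒦 C := by
  have hcard : 𝒳ᶜ.card = N - X := by rw [Finset.card_compl, Fintype.card_fin, h𝒳]
  have hpos : (0 : ℝ) < (N : ℝ) - X := by
    have : (X : ℝ) < N := by exact_mod_cast (by omega : X < N)
    linarith
  obtain ⟨𝒯, h𝒯, h𝒯c, hle⟩ := exists_subset_proportional _
    (hs.entropic.sum_marginal_le (a 𝒦') (𝒳.inf s ⊓ Finset.univ.inf (q 𝒦') ⊓ C.inf w)) T 𝒳ᶜ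
    (by omega)
  rw [hcard, Nat.cast_sub (by omega)] at hle
  have hq : Finset.univ.inf (q 𝒦') ≤ 𝒯.inf (q 𝒦') := Finset.inf_mono (Finset.subset_univ _)
  have h₁ := hs.entropic.submod_le
    (r := 𝒯.inf (a 𝒦') ⊓ (𝒳.inf s ⊓ 𝒯.inf (q 𝒦') ⊓ C.inf w))
    (s := 𝒳.inf s ⊓ Finset.univ.inf (q 𝒦') ⊓ C.inf w)
    (t := 𝒯.inf (a 𝒦') ⊓ (𝒳.inf s ⊓ Finset.univ.inf (q 𝒦') ⊓ C.inf w))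
    (u := 𝒳.inf s ⊓ 𝒯.inf (q 𝒦') ⊓ C.inf w) (by order) (by order) (by order)
  have h₂ := hs.conditional_answers_le h𝒦 𝒯 𝒳 C
  rw [hs.private_answer 𝒯 h𝒯c.le 𝒦 𝒦' h𝒦 h𝒦', hs.private_query 𝒯 h𝒯c.le 𝒦 𝒦' h𝒦 h𝒦'] at h₂
  have h₃ : h (𝒯.inf (a 𝒦) ⊓ (𝒳.inf s ⊓ Finset.univ.inf (q 𝒦) ⊓ C.inf w)) ≤
      h (𝒳ᶜ.inf (a 𝒦) ⊓ (𝒳.inf s ⊓ Finset.univ.inf (q 𝒦) ⊓ C.inf w)) :=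
    hs.entropic.anti (inf_le_inf_right _ (Finset.inf_mono h𝒯))
  rw [div_mul_eq_mul_div, div_le_iff₀ hpos, mul_comm (residual h w s q a 𝒳 𝒦 C)]
  refine hle.trans (mul_le_mul_of_nonneg_left ?_ hpos.le)
  rw [residual]
  linarith

lemma geometric_le_residual (hs : IsScheme h X T M ℓ w s q a) (hNXT : X + T < N)
    {𝒳 : Finset (Fin N)} (h𝒳 : 𝒳.card = X) (m : ℕ) {𝒦 C : Finset (Fin K)} (h𝒦 : 𝒦.card = M)
    (hC : Disjoint C 𝒦) (hm : C.card + m * M ≤ K) :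
    M * ℓ * ∑ j ∈ Finset.range m, ((T : ℝ) / ((N : ℝ) - X)) ^ j ≤ residual h w s q a 𝒳 𝒦 C := by
  have hpos : (0 : ℝ) < (N : ℝ) - X := by
    have : (X : ℝ) < N := by exact_mod_cast (by omega : X < N)
    linarith
  induction m generalizing 𝒦 C with
  | zero => simpa using hs.residual_nonneg 𝒳 𝒦 C
  | succ m ih =>
    rw [hs.residual_eq h𝒳 h𝒦 hC]
    have hcard : (C ∪ 𝒦).card = C.card + M := by rw [Finset.card_union_of_disjoint hC, h𝒦]
    rw [add_mul, one_mul] at hm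
    rcases Nat.eq_zero_or_pos m with rfl | hmpos
    · simpa using hs.residual_nonneg 𝒳 𝒦 (C ∪ 𝒦)
    have hMm : M ≤ m * M := Nat.le_mul_of_pos_left M hmpos
    obtain ⟨𝒦', hsub, h𝒦'⟩ := Finset.exists_subset_card_eq (s := (C ∪ 𝒦)ᶜ) (n := M)
      (by rw [Finset.card_compl, Fintype.card_fin]; omega)
    have hdisj : Disjoint (C ∪ 𝒦) 𝒦' :=
      Finset.disjoint_of_subset_right hsub disjoint_compl_right
    have h₁ := mul_le_mul_of_nonneg_left (ih h𝒦' hdisj (by omega))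
      (by positivity : (0 : ℝ) ≤ (T : ℝ) / ((N : ℝ) - X))
    have h₂ := hs.residual_private hNXT h𝒳 h𝒦 h𝒦' (C ∪ 𝒦)
    rw [Finset.sum_range_succ', pow_zero]
    simp only [pow_succ, ← Finset.sum_mul]
    linarith

/-- The converse bound on the total download. -/
theorem download_bound (hs : IsScheme h X T M ℓ w s q a) (hNXT : X + T < N)
    (hMK : M ≤ K) (D : Fin N → ℝ)
    (hD : ∀ 𝒦 : Finset (Fin K), 𝒦.card = M → ∀ n, h (a 𝒦 n) ≤ D n) :
    M * ℓ * ((N : ℝ) / ((N : ℝ) - X)) *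
      ∑ j ∈ Finset.range (K / M), ((T : ℝ) / ((N : ℝ) - X)) ^ j ≤ ∑ n, D n := by
  have hpos : (0 : ℝ) < (N : ℝ) - X := by
    have : (X : ℝ) < N := by exact_mod_cast (by omega : X < N)
    linarith
  obtain ⟨𝒳, -, h𝒳, hshare⟩ := exists_subset_proportional (fun V => ∑ n ∈ V, D n)
    (fun V => (Finset.sum_congr rfl fun i hi => by
      rw [← Finset.add_sum_erase V D hi, add_sub_cancel_right]).le) X Finset.univ
    (by rw [Finset.card_univ, Fintype.card_fin]; omega)
  rw [Finset.card_univ, Fintype.card_fin] at hshare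
  obtain ⟨𝒦, -, h𝒦⟩ := Finset.exists_subset_card_eq (s := (Finset.univ : Finset (Fin K))) (n := M)
    (by simpa using hMK)
  have h₁ := hs.geometric_le_residual hNXT h𝒳 (K / M) h𝒦 (Finset.disjoint_empty_left 𝒦)
    (by simpa using Nat.div_mul_le_self K M)
  have h₂ : residual h w s q a 𝒳 𝒦 ∅ ≤ ∑ n ∈ 𝒳ᶜ, D n :=
    (sub_le_iff_le_add.2 (hs.entropic.inf_le_add _ _)).trans
      ((hs.entropic.inf_le_sum _ _).trans (Finset.sum_le_sum fun n _ => hD 𝒦 h𝒦 n))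
  have h₃ := Finset.sum_add_sum_compl 𝒳 D
  have h₄ := mul_le_mul_of_nonneg_left (h₁.trans h₂) (Nat.cast_nonneg (α := ℝ) N)
  rw [mul_div_assoc', div_mul_eq_mul_div, div_le_iff₀ hpos]
  nlinarith

end IsScheme

end Lattice

section Kernel

variable {Ω : Type*}

lemma ker_prodMk {α β : Type*} (Y : Ω → α) (Z : Ω → β) :
    Setoid.ker (fun ω => (Y ω, Z ω)) = Setoid.ker Y ⊓ Setoid.ker Z := by
  ext x y
  simp [Setoid.ker_def, Setoid.inf_def]

lemma finset_inf_ker_iff {ι : Type*} {α : ι → Type*} (U : Finset ι) (Y : ∀ i, Ω → α i) (x y : Ω) :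
    (U.inf fun i => Setoid.ker (Y i)) x y ↔ ∀ i ∈ U, Y i x = Y i y := by
  induction U using Finset.induction_on with
  | empty => exact ⟨fun _ i hi => absurd hi (Finset.notMem_empty i), fun _ => trivial⟩
  | insert i U hi ih =>
    rw [Finset.inf_insert, Finset.forall_mem_insert, ← ih]
    rfl

lemma ker_subtype_pi {ι : Type*} {α : ι → Type*} (U : Finset ι) (Y : ∀ i, Ω → α i) :
    Setoid.ker (fun ω => fun i : U => Y i.1 ω) = U.inf fun i => Setoid.ker (Y i) := by
  ext x y
  rw [finset_inf_ker_iff]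
  simp [Setoid.ker_def, funext_iff]

lemma ker_pi {ι : Type*} [Fintype ι] {α : ι → Type*} (Y : ∀ i, Ω → α i) :
    Setoid.ker (fun ω => fun i => Y i ω) = Finset.univ.inf fun i => Setoid.ker (Y i) := by
  ext x y
  rw [finset_inf_ker_iff]
  simp [Setoid.ker_def, funext_iff]

end Kernel

section Entropy

variable {Ω : Type} [Fintype Ω] {p : Ω → ℝ}

/-- Probability of the `r`-class of `ω`. -/
def classProb (p : Ω → ℝ) (r : Setoid Ω) (ω : Ω) : ℝ :=
  ∑ ω', if r ω' ω then p ω' else 0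

/-- Entropy of the partition of `Ω` into `r`-classes. -/
def partEntropy (p : Ω → ℝ) (r : Setoid Ω) : ℝ :=
  ∑ ω, p ω * -Real.log (classProb p r ω)

lemma H_eq_partEntropy {α : Type*} [Fintype α] (Y : Ω → α) :
    H p Y = partEntropy p (Setoid.ker Y) := by
  have h₁ : ∀ a, Real.negMulLog (distOf p Y a) =
      ∑ ω, if Y ω = a then p ω * -Real.log (distOf p Y (Y ω)) else 0 := by
    intro a
    rw [Real.negMulLog, neg_mul, ← mul_neg]
    nth_rewrite 1 [distOf]
    rw [Finset.sum_mul]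
    refine Finset.sum_congr rfl fun ω _ => ?_
    split_ifs with h
    · rw [h]
    · rw [zero_mul]
  simp only [H, h₁]
  rw [Finset.sum_comm]
  simp only [Finset.sum_ite_eq, Finset.mem_univ, if_true]
  rfl

lemma le_classProb (hp : ∀ ω, 0 ≤ p ω) (r : Setoid Ω) {ω ω' : Ω} (h : r ω' ω) :
    p ω' ≤ classProb p r ω := by
  have := Finset.single_le_sum (f := fun ω' => if r ω' ω then p ω' else 0)
    (fun i _ => by split_ifs <;> simp [hp]) (Finset.mem_univ ω')
  simpa [classProb, h] using this

lemma classProb_nonneg (hp : ∀ ω, 0 ≤ p ω) (r : Setoid Ω) (ω : Ω) : 0 ≤ classProb p r ω :=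
  (hp ω).trans (le_classProb hp r (r.refl ω))

lemma classProb_congr {r : Setoid Ω} {ω ω' : Ω} (h : r ω ω') :
    classProb p r ω = classProb p r ω' := by
  refine Finset.sum_congr rfl fun x _ => ?_
  have : r x ω ↔ r x ω' := ⟨fun hx => r.trans hx h, fun hx => r.trans hx (r.symm h)⟩
  simp only [this]

lemma classProb_mono (hp : ∀ ω, 0 ≤ p ω) {r s : Setoid Ω} (h : r ≤ s) (ω : Ω) :
    classProb p r ω ≤ classProb p s ω := by
  refine Finset.sum_le_sum fun x _ => ?_
  by_cases hx : r x ω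
  · rw [if_pos hx, if_pos (h hx)]
  · rw [if_neg hx]
    split_ifs <;> simp [hp]

/-- Normalised class weights sum to at most one over any set of mutually equivalent points. -/
lemma sum_div_classProb_le_one (hp : ∀ ω, 0 ≤ p ω) (r : Setoid Ω) (P : Ω → Prop)
    [DecidablePred P] (hP : ∀ ω ω', P ω → P ω' → r ω ω') :
    ∑ ω, (if P ω then p ω / classProb p r ω else 0) ≤ 1 := by
  by_cases hex : ∃ ω₀, P ω₀
  · obtain ⟨ω₀, h₀⟩ := hex
    refine le_trans (Finset.sum_le_sum (g := fun ω =>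
      (if r ω ω₀ then p ω else 0) / classProb p r ω₀) fun ω _ => ?_) ?_
    · by_cases hω : P ω
      · rw [if_pos hω, if_pos (hP ω ω₀ hω h₀), classProb_congr (hP ω ω₀ hω h₀)]
      · rw [if_neg hω]
        exact div_nonneg (by split_ifs <;> simp [hp]) (classProb_nonneg hp r ω₀)
    · rw [← Finset.sum_div]
      exact div_self_le_one _
  · push Not at hex
    simp [hex]

/-- The conditionally independent coupling of two partitions given a coarser one has total mass at
most one. -/
lemma sum_coupling_le_one (hp : IsPMF p) {r s u : Setoid Ω} (hr : r ≤ u) (hs : s ≤ u) :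
    ∑ ω, p ω * (classProb p r ω * classProb p s ω /
      (classProb p (r ⊓ s) ω * classProb p u ω)) ≤ 1 := by
  have expand : ∀ ω, p ω * (classProb p r ω * classProb p s ω /
      (classProb p (r ⊓ s) ω * classProb p u ω)) =
      ∑ x, ∑ y, p x * p y * (if r x ω ∧ s y ω then
        p ω / classProb p (r ⊓ s) ω / classProb p u ω else 0) := by
    intro ω
    have h₁ : classProb p r ω * classProb p s ω =
        ∑ x, ∑ y, p x * p y * (if r x ω ∧ s y ω then 1 else 0) := by
      rw [classProb, classProb, Finset.sum_mul_sum]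
      refine Finset.sum_congr rfl fun x _ => Finset.sum_congr rfl fun y _ => ?_
      by_cases hx : r x ω <;> by_cases hy : s y ω <;> simp [hx, hy]
    rw [mul_div_assoc', mul_comm, h₁, mul_div_assoc, Finset.sum_mul]
    refine Finset.sum_congr rfl fun x _ => ?_
    rw [Finset.sum_mul]
    refine Finset.sum_congr rfl fun y _ => ?_
    split_ifs
    · rw [div_div]; ring
    · simp
  simp only [expand]
  rw [Finset.sum_comm]
  have inner : ∀ x y, ∑ ω, p x * p y * (if r x ω ∧ s y ω then
      p ω / classProb p (r ⊓ s) ω / classProb p u ω else 0) ≤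
      p x * ((if u y x then p y else 0) / classProb p u x) := by
    intro x y
    by_cases hyx : u y x
    · rw [if_pos hyx, ← Finset.mul_sum, mul_assoc]
      refine mul_le_mul_of_nonneg_left ?_ (hp.1 x)
      rw [div_eq_mul_inv]
      refine mul_le_mul_of_nonneg_left ?_ (hp.1 y)
      have h₁ : ∀ ω, (if r x ω ∧ s y ω then
          p ω / classProb p (r ⊓ s) ω / classProb p u ω else 0) =
          (if r x ω ∧ s y ω then p ω / classProb p (r ⊓ s) ω else 0) * (classProb p u x)⁻¹ := by
        intro ω
        split_ifs with h
        · rw [classProb_congr (hr h.1), div_eq_mul_inv (_ / _)]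
        · rw [zero_mul]
      simp only [h₁]
      rw [← Finset.sum_mul]
      refine mul_le_of_le_one_left (inv_nonneg.2 (classProb_nonneg hp.1 u x)) ?_
      exact sum_div_classProb_le_one hp.1 (r ⊓ s) (fun ω => r x ω ∧ s y ω) fun ω ω' h h' =>
        ⟨r.trans (r.symm h.1) h'.1, s.trans (s.symm h.2) h'.2⟩
    · rw [if_neg hyx, zero_div, mul_zero]
      refine (Finset.sum_eq_zero fun ω _ => ?_).le
      rw [if_neg, mul_zero]
      exact fun h => hyx (u.trans (hs h.2) (u.symm (hr h.1)))
  calc _ = ∑ x, ∑ y, ∑ ω, p x * p y * (if r x ω ∧ s y ω then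
        p ω / classProb p (r ⊓ s) ω / classProb p u ω else 0) :=
        Finset.sum_congr rfl fun x _ => Finset.sum_comm
    _ ≤ ∑ x, ∑ y, p x * ((if u y x then p y else 0) / classProb p u x) :=
        Finset.sum_le_sum fun x _ => Finset.sum_le_sum fun y _ => inner x y
    _ = ∑ x, p x * (classProb p u x / classProb p u x) := by
        simp only [← Finset.mul_sum, ← Finset.sum_div, classProb]
    _ ≤ ∑ x, p x :=
        Finset.sum_le_sum fun x _ => mul_le_of_le_one_right (hp.1 x) (div_self_le_one _)
    _ = 1 := hp.2

lemma isEntropic_partEntropy (hp : IsPMF p) : IsEntropic (partEntropy p) where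
  map_top := by
    have : ∀ ω, classProb p ⊤ ω = 1 := fun ω => by
      simp [classProb, hp.2, Setoid.top_def]
    simp [partEntropy, this]
  anti r s hrs := by
    refine Finset.sum_le_sum fun ω _ => ?_
    rcases (hp.1 ω).eq_or_lt with h0 | hpos
    · simp [← h0]
    · refine mul_le_mul_of_nonneg_left (neg_le_neg (Real.log_le_log ?_ ?_)) hpos.le
      · exact hpos.trans_le (le_classProb hp.1 r (r.refl ω))
      · exact classProb_mono hp.1 hrs ω
  submod {r s u} hr hs := by
    have key : ∀ ω, p ω * -Real.log (classProb p (r ⊓ s) ω) + p ω * -Real.log (classProb p u ω) ≤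
        p ω * -Real.log (classProb p r ω) + p ω * -Real.log (classProb p s ω) +
        (p ω * (classProb p r ω * classProb p s ω /
          (classProb p (r ⊓ s) ω * classProb p u ω)) - p ω) := by
      intro ω
      rcases (hp.1 ω).eq_or_lt with h0 | hpos
      · simp [← h0]
      · have pos : ∀ t : Setoid Ω, 0 < classProb p t ω := fun t =>
          hpos.trans_le (le_classProb hp.1 t (t.refl ω))
        have h₁ := Real.log_le_sub_one_of_pos (div_pos (mul_pos (pos r) (pos s))
          (mul_pos (pos (r ⊓ s)) (pos u)))
        rw [Real.log_div (mul_pos (pos r) (pos s)).ne' (mul_pos (pos (r ⊓ s)) (pos u)).ne',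
          Real.log_mul (pos r).ne' (pos s).ne', Real.log_mul (pos (r ⊓ s)).ne' (pos u).ne'] at h₁
        have h₂ := mul_le_mul_of_nonneg_left h₁ hpos.le
        linarith
    have hsum := Finset.sum_le_sum fun ω (_ : ω ∈ Finset.univ) => key ω
    simp only [Finset.sum_add_distrib, Finset.sum_sub_distrib, hp.2] at hsum
    have := sum_coupling_le_one hp hr hs
    simp only [partEntropy]
    linarith

/-- Identically distributed variables have identically distributed images, of equal entropy. -/
lemma H_comp_congr {α β : Type*} [Fintype α] [Fintype β] {Y Z : Ω → α}
    (hYZ : ∀ t, distOf p Y t = distOf p Z t) (g : α → β) :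
    H p (fun ω => g (Y ω)) = H p (fun ω => g (Z ω)) := by
  have push : ∀ (Y : Ω → α) (b : β), distOf p (fun ω => g (Y ω)) b =
      ∑ t, if g t = b then distOf p Y t else 0 := by
    intro Y b
    simp only [distOf, ← Finset.sum_filter (fun t => g t = b)]
    rw [Finset.sum_comm]
    refine Finset.sum_congr rfl fun ω _ => ?_
    simp [Finset.sum_ite_eq]
  simp only [H, push, hYZ]

end Entropy

end SDMM

/-- **Theorem 1 of MM-XSTPIR, regime `N > X + T`.**
For any MM-XSTPIR scheme with `N` servers, `K` mutually independent messages of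
entropy `ℓ` each, `X`-secure storage, `T`-private queries, and retrieval sets of
size `M`, the total download satisfies `Σₙ Dₙ ≥ Mℓ·(N/(N-X))·Σ_{j<⌊K/M⌋}(T/(N-X))ʲ`; hence the rate
`Mℓ / Σₙ Dₙ` is at most `((N-X)/N)·(Σ_{j<⌊K/M⌋}(T/(N-X))ʲ)⁻¹`. -/
theorem mm_xstpir_converse_large_N
    (N K X T M : ℕ) (ℓ : ℝ) (hℓ : 0 < ℓ)
    (hXN : X < N) (hNXT : X + T < N) (hM : 0 < M) (hMK : M ≤ K)
    (Ω : Type) [Fintype Ω] (p : Ω → ℝ) (hp : SDMM.IsPMF p)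
    (𝒲 : Fin K → Type) [∀ k, Fintype (𝒲 k)]
    (𝒮 : Fin N → Type) [∀ n, Fintype (𝒮 n)]
    (𝒬 : Fin N → Type) [∀ n, Fintype (𝒬 n)]
    (𝒜 : Fin N → Type) [∀ n, Fintype (𝒜 n)]
    (W : ∀ k, Ω → 𝒲 k) (S : ∀ n, Ω → 𝒮 n)
    (Q : Finset (Fin K) → ∀ n, Ω → 𝒬 n)
    (A : Finset (Fin K) → ∀ n, Ω → 𝒜 n)
    -- each message has entropy ℓ, and the messages are mutually independent
    (hWent : ∀ k, SDMM.H p (W k) = ℓ)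
    (hWindep : SDMM.H p (fun ω => (fun k => W k ω)) = ∑ k, SDMM.H p (W k))
    -- the messages are a function of the total storage
    (hWS : SDMM.Hc p (fun ω => (fun k => W k ω)) (fun ω => (fun n => S n ω)) = 0)
    -- X-security of the storage
    (hsec : ∀ 𝒳 : Finset (Fin N), 𝒳.card = X →
      SDMM.MI p (fun ω => (fun n : 𝒳 => S n.1 ω)) (fun ω => (fun k => W k ω)) = 0)
    -- queries are independent of the storage
    (hSQ : ∀ 𝒦 : Finset (Fin K), 𝒦.card = M →
      SDMM.MI p (fun ω => (fun n => S n ω)) (fun ω => (fun n => Q 𝒦 n ω)) = 0)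
    -- each answer is a function of the corresponding query and storage
    (hans : ∀ (𝒦 : Finset (Fin K)), 𝒦.card = M → ∀ n,
      SDMM.Hc p (A 𝒦 n) (fun ω => (Q 𝒦 n ω, S n ω)) = 0)
    -- correctness: desired messages decodable from all answers and queries
    (hcorrect : ∀ 𝒦 : Finset (Fin K), 𝒦.card = M →
      SDMM.Hc p (fun ω => (fun k : 𝒦 => W k.1 ω))
        (fun ω => ((fun n => A 𝒦 n ω), (fun n => Q 𝒦 n ω))) = 0)
    -- T-privacy: transcripts at any ≤ T servers are identically distributed
    (hpriv : ∀ 𝒯 : Finset (Fin N), 𝒯.card ≤ T →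
      ∀ 𝒦 𝒦' : Finset (Fin K), 𝒦.card = M → 𝒦'.card = M →
      ∀ t, SDMM.distOf p (fun ω => ((fun n : 𝒯 => Q 𝒦 n.1 ω),
              (fun n : 𝒯 => A 𝒦 n.1 ω), (fun n => S n ω), (fun k => W k ω))) t =
           SDMM.distOf p (fun ω => ((fun n : 𝒯 => Q 𝒦' n.1 ω),
              (fun n : 𝒯 => A 𝒦' n.1 ω), (fun n => S n ω), (fun k => W k ω))) t)
    -- per-server download costs
    (Dl : Fin N → ℝ)
    (hD : ∀ 𝒦 : Finset (Fin K), 𝒦.card = M → ∀ n, SDMM.H p (A 𝒦 n) ≤ Dl n) :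
    (M : ℝ) * ℓ * ((N : ℝ) / ((N : ℝ) - (X : ℝ))) *
      (∑ j ∈ Finset.range (K / M), ((T : ℝ) / ((N : ℝ) - (X : ℝ))) ^ j) ≤ ∑ n, Dl n ∧
      (M : ℝ) * ℓ / ∑ n, Dl n ≤ ((N : ℝ) - (X : ℝ)) / (N : ℝ) *
        (∑ j ∈ Finset.range (K / M), ((T : ℝ) / ((N : ℝ) - (X : ℝ))) ^ j)⁻¹ := by
  have hent := SDMM.isEntropic_partEntropy hp
  have hscheme : SDMM.IsScheme (SDMM.partEntropy p) X T M ℓ (fun k => Setoid.ker (W k))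
      (fun n => Setoid.ker (S n)) (fun 𝒦 n => Setoid.ker (Q 𝒦 n))
      (fun 𝒦 n => Setoid.ker (A 𝒦 n)) := by
    simp only [SDMM.Hc, SDMM.MI, SDMM.H_eq_partEntropy, SDMM.ker_prodMk, SDMM.ker_subtype_pi]
      at hWent hWindep hWS hsec hSQ hans hcorrect
    simp only [SDMM.ker_pi] at hWindep hWS hsec hSQ hcorrect
    refine ⟨hent, hWent, hWindep, ?_, fun 𝒳 h𝒳 => ?_, fun 𝒦 h𝒦 => ?_, fun 𝒦 h𝒦 n => ?_,
      fun 𝒦 h𝒦 => ?_, fun 𝒯 h𝒯 𝒦 𝒦' h𝒦 h𝒦' 𝒳 C => ?_, fun 𝒯 h𝒯 𝒦 𝒦' h𝒦 h𝒦' 𝒳 C => ?_⟩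
    · rw [inf_comm]; linarith
    · linarith [hsec 𝒳 h𝒳]
    · linarith [hSQ 𝒦 h𝒦]
    · rw [inf_comm]; linarith [hans 𝒦 h𝒦 n]
    · rw [inf_comm]; linarith [hcorrect 𝒦 h𝒦]
    · have := SDMM.H_comp_congr (hpriv 𝒯 h𝒯 𝒦 𝒦' h𝒦 h𝒦') fun t =>
        (t.2.1, ((fun n : 𝒳 => t.2.2.1 n.1), t.1), fun k : C => t.2.2.2 k.1)
      simpa only [SDMM.H_eq_partEntropy, SDMM.ker_prodMk, SDMM.ker_subtype_pi] using this
    · have := SDMM.H_comp_congr (hpriv 𝒯 h𝒯 𝒦 𝒦' h𝒦 h𝒦') fun t =>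
        (((fun n : 𝒳 => t.2.2.1 n.1), t.1), fun k : C => t.2.2.2 k.1)
      simpa only [SDMM.H_eq_partEntropy, SDMM.ker_prodMk, SDMM.ker_subtype_pi] using this
  have hbound := hscheme.download_bound hNXT hMK Dl fun 𝒦 h𝒦 n =>
    SDMM.H_eq_partEntropy (A 𝒦 n) ▸ hD 𝒦 h𝒦 n
  refine ⟨hbound, ?_⟩
  have hpos : (0 : ℝ) < (N : ℝ) - X := sub_pos.2 (by exact_mod_cast hXN)
  have hN : (0 : ℝ) < N := by exact_mod_cast (by omega : 0 < N)
  have hM' : (0 : ℝ) < M := by exact_mod_cast hM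
  have hgeom : 0 < ∑ j ∈ Finset.range (K / M), ((T : ℝ) / ((N : ℝ) - X)) ^ j := by
    rw [← Nat.succ_pred_eq_of_pos (Nat.div_pos hMK hM), Finset.sum_range_succ']
    positivity
  have hDpos := lt_of_lt_of_le (by positivity) hbound
  rw [div_le_iff₀ hDpos]
  refine le_trans (le_of_eq ?_) (mul_le_mul_of_nonneg_left hbound (by positivity))
  field_simp
end
end
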